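/- arXiv:math/0304475 — 7 statements merged into one kernel-verified Lean document; each statement's English description precedes it below -/
import Mathlib

section
/- Let X be a compact metric space and T : X → X a homeomorphism. If the topological entropy of T is zero, then the topological entropy of the induced homeomorphism on the space of Borel probability measures on X is also zero. Here the induced homeomorphism sends a probability measure μ to its pushforward T_*μ, and the space of Borel probability measures on X carries the weak* topology (under which it is a compact metrizable space). -/
open MeasureTheory

/-- A second moment version of Maurey's empirical method. -/
lemma exists_sum_sq_sum_sub_integral_le {X κ : Type*} [MeasurableSpace X] [Fintype κ]
    (μ : Measure X) [IsProbabilityMeasure μ] {g : κ → X → ℝ} {C : ℝ}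
    (hg : ∀ i, Measurable (g i)) (hC : ∀ i x, |g i x| ≤ C) (K : ℕ) :
    ∃ y : Fin K → X, ∑ i, (∑ j, (g i (y j) - ∫ x, g i x ∂μ)) ^ 2
      ≤ K * (Fintype.card κ * C ^ 2) := by
  induction K with
  | zero => exact ⟨Fin.elim0, by simp⟩
  | succ K ih =>
    obtain ⟨y, hy⟩ := ih
    set m : κ → ℝ := fun i ↦ ∫ x, g i x ∂μ
    set S : κ → ℝ := fun i ↦ ∑ j, (g i (y j) - m i)
    have hint : ∀ i, Integrable (g i) μ := fun i ↦
      .of_bound (hg i).aestronglyMeasurable C (.of_forall (hC i))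
    have hsq : ∀ i x, (g i x) ^ 2 ≤ C ^ 2 := fun i x ↦ sq_le_sq' (abs_le.1 (hC i x)).1
      (abs_le.1 (hC i x)).2
    have hint2 : ∀ i, Integrable (fun x ↦ (g i x) ^ 2) μ := fun i ↦
      .of_bound ((hg i).pow_const 2).aestronglyMeasurable (C ^ 2)
        (.of_forall fun x ↦ by simpa using hsq i x)
    have hexp : ∀ i x, ((g i x - m i) + S i) ^ 2
        = (g i x) ^ 2 + (2 * (S i - m i) * g i x + (S i - m i) ^ 2) := fun i x ↦ by ring
    have hI : ∀ i, Integrable (fun x ↦ ((g i x - m i) + S i) ^ 2) μ := fun i ↦ by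
      simp only [hexp]
      exact (hint2 i).add (((hint i).const_mul _).add (integrable_const _))
    have hle : ∀ i, ∫ x, ((g i x - m i) + S i) ^ 2 ∂μ ≤ (S i) ^ 2 + C ^ 2 := fun i ↦ by
      have h1 : ∫ x, (g i x) ^ 2 ∂μ ≤ C ^ 2 := by
        simpa using integral_mono (hint2 i) (integrable_const (C ^ 2)) (hsq i)
      simp only [hexp]
      rw [integral_add (hint2 i) (g := fun x ↦ 2 * (S i - m i) * g i x + (S i - m i) ^ 2)
          (((hint i).const_mul _).add (integrable_const _)),
        integral_add ((hint i).const_mul _) (integrable_const _), integral_const_mul]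
      simp only [integral_const, probReal_univ, one_smul]
      change _ + (2 * (S i - m i) * m i + _) ≤ _
      nlinarith [sq_nonneg (m i)]
    obtain ⟨x, hx⟩ := exists_le_integral (μ := μ)
      (f := fun x ↦ ∑ i, ((g i x - m i) + S i) ^ 2) (integrable_finsetSum _ fun i _ ↦ hI i)
    refine ⟨Fin.cons x y, ?_⟩
    simp only [Fin.sum_univ_succ, Fin.cons_zero, Fin.cons_succ]
    refine hx.trans ?_
    rw [integral_finsetSum _ fun i _ ↦ hI i]
    refine (Finset.sum_le_sum fun i _ ↦ hle i).trans ?_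
    rw [Finset.sum_add_distrib]
    simp only [Finset.sum_const, Finset.card_univ, nsmul_eq_mul]
    push_cast
    linarith

/-- Integer vectors with bounded coordinates and small `ℓ¹` norm are few. -/
lemma card_filter_sum_natAbs_le {κ : Type*} [Fintype κ] [DecidableEq κ] (L : ℕ)
    {a M : ℝ} (ha : 0 ≤ a) :
    (((Fintype.piFinset fun _ : κ ↦ Finset.Icc (-(L : ℤ)) L).filter
      fun q ↦ ((∑ i, (q i).natAbs : ℕ) : ℝ) ≤ M).card : ℝ)
      ≤ Real.exp (a * M + 2 * L * Real.exp (-a) * Fintype.card κ) := by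
  set B := (Fintype.piFinset fun _ : κ ↦ Finset.Icc (-(L : ℤ)) L)
  have hsum : ∑ z ∈ Finset.Icc (-(L : ℤ)) L, Real.exp (-a * z.natAbs)
      ≤ Real.exp (2 * L * Real.exp (-a)) := by
    have h0 : (0 : ℤ) ∈ Finset.Icc (-(L : ℤ)) L := by simp
    rw [← Finset.add_sum_erase _ _ h0]
    have : ∑ z ∈ (Finset.Icc (-(L : ℤ)) L).erase 0, Real.exp (-a * z.natAbs)
        ≤ ∑ z ∈ (Finset.Icc (-(L : ℤ)) L).erase 0, Real.exp (-a) := by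
      refine Finset.sum_le_sum fun z hz ↦ Real.exp_le_exp.2 ?_
      have : (1 : ℝ) ≤ z.natAbs := by
        exact_mod_cast Int.natAbs_pos.2 (Finset.ne_of_mem_erase hz)
      nlinarith
    rw [Finset.sum_const, Finset.card_erase_of_mem h0, Int.card_Icc,
      show ((L : ℤ) + 1 - -L).toNat - 1 = 2 * L by omega, nsmul_eq_mul] at this
    push_cast at this
    have h2 := Real.add_one_le_exp (2 * L * Real.exp (-a))
    simp only [Int.natAbs_zero, Nat.cast_zero, mul_zero, Real.exp_zero]
    linarith
  have hprod : ∑ q ∈ B, Real.exp (-a * (∑ i, (q i).natAbs : ℕ))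
      ≤ Real.exp (2 * L * Real.exp (-a) * Fintype.card κ) := by
    have : ∀ q : κ → ℤ, Real.exp (-a * (∑ i, (q i).natAbs : ℕ))
        = ∏ i, Real.exp (-a * (q i).natAbs) := fun q ↦ by
      rw [← Real.exp_sum]; push_cast; rw [Finset.mul_sum]
    simp only [this]
    rw [← Finset.prod_univ_sum (fun _ : κ ↦ Finset.Icc (-(L : ℤ)) L)
      fun _ z ↦ Real.exp (-a * z.natAbs)]
    refine (Finset.prod_le_prod (fun _ _ ↦ Finset.sum_nonneg fun _ _ ↦ (Real.exp_pos _).le)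
      fun _ _ ↦ hsum).trans ?_
    rw [Finset.prod_const, Finset.card_univ, ← Real.exp_nat_mul, mul_comm]
  have hlow : ((B.filter fun q ↦ ((∑ i, (q i).natAbs : ℕ) : ℝ) ≤ M).card : ℝ) * Real.exp (-a * M)
      ≤ ∑ q ∈ B, Real.exp (-a * (∑ i, (q i).natAbs : ℕ)) := by
    rw [← nsmul_eq_mul, ← Finset.sum_const]
    refine (Finset.sum_le_sum fun q hq ↦ ?_).trans (Finset.sum_le_sum_of_subset_of_nonneg
      (Finset.filter_subset _ _) fun _ _ _ ↦ (Real.exp_pos _).le)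
    have := (Finset.mem_filter.1 hq).2
    exact Real.exp_le_exp.2 (by nlinarith)
  have := hlow.trans hprod
  rw [neg_mul, Real.exp_neg, ← div_eq_mul_inv, div_le_iff₀ (Real.exp_pos _)] at this
  rwa [add_comm, Real.exp_add]

/-- A map into a finite set of codes whose fibres are small for `U` bounds `coverMincard`. -/
lemma coverMincard_le_card_of_codes {Y β : Type*} {S : Y → Y} {U : SetRel Y Y} {n : ℕ}
    {B : Finset β} (P : Y → β → Prop) (hB : ∀ μ, ∃ b ∈ B, P μ b)
    (hP : ∀ μ ν b, P μ b → P ν b → (μ, ν) ∈ Dynamics.dynEntourage S U n) :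
    Dynamics.coverMincard S Set.univ U n ≤ B.card := by
  classical
  rcases isEmpty_or_nonempty Y with hY | hY
  · rw [Set.univ_eq_empty_iff.2 hY, Dynamics.coverMincard_empty]; exact zero_le
  have : ∀ b, ∃ ν, (∃ μ, P μ b) → P ν b := fun b ↦ by
    by_cases h : ∃ μ, P μ b
    · exact h.imp fun _ h _ ↦ h
    · exact ⟨Classical.arbitrary Y, fun h' ↦ (h h').elim⟩
  choose r hr using this
  refine (Dynamics.IsDynCoverOf.coverMincard_le_card (s := B.image r) fun μ _ ↦ ?_).trans
    (by exact_mod_cast Finset.card_image_le)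
  obtain ⟨b, hb, h⟩ := hB μ
  exact ⟨r b, by simpa using ⟨b, hb, rfl⟩, hP μ (r b) b h (hr b ⟨μ, h⟩)⟩

/-- Entourages of the weak* topology are controlled by finitely many continuous functions. -/
lemma exists_finset_forall_abs_integral_sub_lt {X : Type*} [MetricSpace X] [CompactSpace X]
    [MeasurableSpace X] [BorelSpace X] (u : UniformSpace (ProbabilityMeasure X))
    (hu : u.toTopologicalSpace = (inferInstance : TopologicalSpace (ProbabilityMeasure X)))
    {U : SetRel (ProbabilityMeasure X) (ProbabilityMeasure X)} (hU : U ∈ @uniformity _ u) :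
    ∃ F : Finset (BoundedContinuousFunction X ℝ), ∀ μ ν : ProbabilityMeasure X,
      (∀ f ∈ F, |∫ x, f x ∂(μ : Measure X) - ∫ x, f x ∂(ν : Measure X)| < 1) → (μ, ν) ∈ U := by
  classical
  let Φ : ProbabilityMeasure X → BoundedContinuousFunction X ℝ → ℝ :=
    fun μ f ↦ ∫ x, f x ∂(μ : Measure X)
  have hΦ : Topology.IsInducing Φ := by
    refine Topology.isInducing_iff_nhds.2 fun μ ↦ le_antisymm ?_ ?_
    · rw [← Filter.tendsto_iff_comap]
      exact tendsto_pi_nhds.2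
        (ProbabilityMeasure.tendsto_iff_forall_integral_tendsto.1 Filter.tendsto_id)
    · exact (ProbabilityMeasure.tendsto_iff_forall_integral_tendsto (μs := id)).2
        (tendsto_pi_nhds.1 (Filter.tendsto_comap (f := Φ)))
  have huu : u = UniformSpace.comap Φ inferInstance :=
    unique_uniformity_of_compact hu hΦ.eq_induced.symm
  rw [huu, uniformity_comap, Pi.uniformity] at hU
  obtain ⟨V, hV, hVU⟩ := hU
  have hb := Filter.HasBasis.iInf' fun f : BoundedContinuousFunction X ℝ ↦
    (Metric.uniformity_basis_dist (α := ℝ)).comap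
      (fun a : (BoundedContinuousFunction X ℝ → ℝ) × (BoundedContinuousFunction X ℝ → ℝ) ↦
        (a.1 f, a.2 f))
  obtain ⟨⟨I, ε⟩, ⟨hI, hε⟩, hIV⟩ := hb.mem_iff.1 hV
  refine ⟨hI.toFinset.image fun f ↦ (ε f)⁻¹ • f, fun μ ν h ↦ hVU (hIV ?_)⟩
  simp only [Set.mem_iInter]
  intro f hf
  have hpos := hε f hf
  have := h _ (Finset.mem_image_of_mem _ (hI.mem_toFinset.2 hf))
  simp only [BoundedContinuousFunction.coe_smul, smul_eq_mul, integral_const_mul] at this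
  rw [← mul_sub, abs_mul, abs_of_pos (inv_pos.2 hpos), inv_mul_lt_iff₀ hpos, mul_one] at this
  exact this

lemma integral_iterate_map {X : Type*} [TopologicalSpace X]
    [MeasurableSpace X] [BorelSpace X] {T : X → X} (hT : Continuous T)
    (f : BoundedContinuousFunction X ℝ) (k : ℕ) (μ : ProbabilityMeasure X) :
    ∫ x, f x ∂(((fun μ : ProbabilityMeasure X ↦ μ.map (f := T) hT.measurable.aemeasurable)^[k] μ :
      ProbabilityMeasure X) : Measure X) = ∫ x, f (T^[k] x) ∂(μ : Measure X) := by
  induction k generalizing μ with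
  | zero => rfl
  | succ k ih =>
    rw [Function.iterate_succ_apply, ih, ProbabilityMeasure.toMeasure_map,
      integral_map hT.measurable.aemeasurable
        (f := fun x ↦ f (T^[k] x))
        (f.continuous.comp (hT.iterate k)).measurable.aestronglyMeasurable]
    rfl

/-- A dynamical cover of `X` yields a dynamical cover of the space of probability measures: encode
a measure by an empirical measure on the cover and the rounded errors. -/
lemma exists_coverMincard_map_le {X : Type*} [TopologicalSpace X] [MeasurableSpace X]
    [BorelSpace X] {T : X → X} (hT : Continuous T) {F : Finset (BoundedContinuousFunction X ℝ)}
    {C : ℝ} (hC : ∀ f ∈ F, ‖f‖ ≤ C) {U : SetRel (ProbabilityMeasure X) (ProbabilityMeasure X)}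
    (hU : ∀ μ ν : ProbabilityMeasure X,
      (∀ f ∈ F, |∫ x, f x ∂(μ : Measure X) - ∫ x, f x ∂(ν : Measure X)| < 1) → (μ, ν) ∈ U)
    {V : SetRel X X} (hV : ∀ f ∈ F, ∀ x y, (x, y) ∈ V → |f x - f y| ≤ 1 / 4)
    {n : ℕ} {s : Finset X} (hs : Dynamics.IsDynCoverOf T Set.univ V n s)
    {K : ℕ} (hK : K ≠ 0) {L : ℕ} (hL : 16 * C ≤ L) {a : ℝ} (ha : 0 ≤ a) :
    ∃ N : ℕ, Dynamics.coverMincard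
        (fun μ : ProbabilityMeasure X ↦ μ.map (f := T) hT.measurable.aemeasurable) Set.univ U n ≤ N ∧
      (N : ℝ) ≤ s.card ^ K
        * Real.exp ((a * (64 * C ^ 2 / K) + 2 * L * Real.exp (-a)) * (F.card * n)) := by
  classical
  let g : F × Fin n → X → ℝ := fun i x ↦ i.1.1 (T^[i.2] x)
  have hgm : ∀ i, Measurable (g i) := fun i ↦
    (i.1.1.continuous.comp (hT.iterate i.2)).measurable
  have hgC : ∀ i x, |g i x| ≤ C := fun i x ↦
    (i.1.1.norm_coe_le_norm _).trans (hC _ i.1.2)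
  have hK0 : (0 : ℝ) < K := by positivity
  set Q := (Fintype.piFinset fun _ : F × Fin n ↦ Finset.Icc (-(L : ℤ)) L).filter
    fun q ↦ ((∑ i, (q i).natAbs : ℕ) : ℝ) ≤ 64 * C ^ 2 / K * (F.card * n) with hQ
  have hcard : Fintype.card (F × Fin n) = F.card * n := by simp
  refine ⟨(Fintype.piFinset (fun _ : Fin K ↦ s) ×ˢ Q).card, ?_, ?_⟩
  · refine coverMincard_le_card_of_codes (fun μ b ↦ ∀ i, |∫ x, g i x ∂(μ : Measure X)
      - ((∑ j, g i (b.1 j)) / K + b.2 i / 4)| ≤ 3 / 8) (fun μ ↦ ?_) fun μ ν b hμ hν ↦ ?_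
    · obtain ⟨y, hy⟩ := exists_sum_sq_sum_sub_integral_le (μ : Measure X) hgm hgC K
      choose c hcs hc using fun j ↦ hs (Set.mem_univ (y j))
      set m : F × Fin n → ℝ := fun i ↦ ∫ x, g i x ∂(μ : Measure X)
      set d : F × Fin n → ℝ := fun i ↦ m i - (∑ j, g i (y j)) / K with hd
      have hdsum : ∀ i, (∑ j, (g i (y j) - m i)) = - (K * d i) := fun i ↦ by
        simp only [hd, Finset.sum_sub_distrib, Finset.sum_const, Finset.card_univ,
          Fintype.card_fin, nsmul_eq_mul]
        field_simp
        ring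
      have hdsq : ∑ i, (d i) ^ 2 ≤ C ^ 2 / K * (F.card * n) := by
        have : ∑ i, (K * d i) ^ 2 ≤ K * ((F.card * n : ℕ) * C ^ 2) := by
          rw [← hcard]
          refine (Finset.sum_congr rfl fun i _ ↦ ?_).trans_le hy
          change _ = (∑ j, (g i (y j) - m i)) ^ 2
          rw [hdsum, neg_sq]
        simp only [mul_pow, ← Finset.mul_sum] at this
        push_cast at this
        rw [div_mul_eq_mul_div, le_div_iff₀ hK0]
        refine le_of_mul_le_mul_left ?_ hK0
        linarith
      have hdC : ∀ i, |d i| ≤ 2 * C := fun i ↦ by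
        have h1 : |m i| ≤ C := by
          simpa using norm_integral_le_of_norm_le_const (μ := (μ : Measure X)) (f := g i)
            (Filter.Eventually.of_forall (hgC i))
        have h2 : |(∑ j, g i (y j)) / K| ≤ C := by
          rw [abs_div, Nat.abs_cast, div_le_iff₀ hK0]
          refine (Finset.abs_sum_le_sum_abs _ _).trans
            ((Finset.sum_le_sum fun j _ ↦ hgC i (y j)).trans ?_)
          simp [mul_comm]
        linarith [abs_sub (m i) ((∑ j, g i (y j)) / K)]
      have hround : ∀ i, |(round (4 * d i) : ℝ)| ≤ 8 * |d i| := fun i ↦ by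
        rcases eq_or_ne (round (4 * d i)) 0 with h0 | h0
        · rw [h0]; simp
        · have h1 := abs_sub_round (4 * d i)
          have h2 : (1 : ℝ) ≤ |(round (4 * d i) : ℝ)| := by
            exact_mod_cast Int.one_le_abs h0
          have h3 := abs_sub_abs_le_abs_sub (round (4 * d i) : ℝ) (4 * d i)
          rw [abs_sub_comm, abs_mul, abs_of_pos (four_pos : (0 : ℝ) < 4)] at h3
          linarith
      refine ⟨(c, fun i ↦ round (4 * d i)), ?_, fun i ↦ ?_⟩
      · simp only [Finset.mem_product, Fintype.mem_piFinset, hQ, Finset.mem_filter, Finset.mem_Icc]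
        refine ⟨hcs, fun i ↦ abs_le.1 ?_, ?_⟩
        · have : |(round (4 * d i) : ℝ)| ≤ L := by linarith [hround i, hdC i]
          exact_mod_cast this
        · have : 64 * C ^ 2 / K * (F.card * n) = 64 * (C ^ 2 / K * (F.card * n)) := by ring
          rw [this]
          refine le_trans ?_ (mul_le_mul_of_nonneg_left hdsq (by norm_num))
          rw [Finset.mul_sum, Nat.cast_sum]
          refine Finset.sum_le_sum fun i _ ↦ ?_
          have h1 : ((round (4 * d i)).natAbs : ℝ) ≤ (round (4 * d i) : ℝ) ^ 2 := by
            simpa using Int.cast_le (R := ℝ).2 (Int.natAbs_le_self_sq (round (4 * d i)))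
          have h2 := pow_le_pow_left₀ (abs_nonneg _) (hround i) 2
          rw [mul_pow, sq_abs, sq_abs] at h2
          linarith
      · have h1 := abs_sub_round (4 * d i)
        have h2 : |(∑ j, g i (y j)) / K - (∑ j, g i (c j)) / K| ≤ 1 / 4 := by
          rw [← sub_div, ← Finset.sum_sub_distrib, abs_div, Nat.abs_cast, div_le_iff₀ hK0]
          refine (Finset.abs_sum_le_sum_abs _ _).trans ((Finset.sum_le_sum fun j _ ↦
            hV _ i.1.2 _ _ (Dynamics.mem_dynEntourage.1 (hc j) i.2 i.2.2)).trans ?_)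
          simp [mul_comm]
        change |m i - _| ≤ _
        rw [abs_le] at h1 h2 ⊢
        simp only [hd] at h1 ⊢
        constructor <;> linarith [h1.1, h1.2, h2.1, h2.2]
    · refine Dynamics.mem_dynEntourage.2 fun k hk ↦ hU _ _ fun f hf ↦ ?_
      rw [integral_iterate_map hT, integral_iterate_map hT]
      have h1 := abs_le.1 (hμ (⟨f, hf⟩, ⟨k, hk⟩))
      have h2 := abs_le.1 (hν (⟨f, hf⟩, ⟨k, hk⟩))
      simp only [g] at h1 h2
      rw [abs_lt]
      constructor <;> linarith [h1.1, h1.2, h2.1, h2.2]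
  · rw [Finset.card_product, Fintype.card_piFinset]
    simp only [Finset.prod_const, Finset.card_univ, Fintype.card_fin]
    push_cast
    refine mul_le_mul_of_nonneg_left ?_ (by positivity)
    refine (card_filter_sum_natAbs_le L ha).trans (Real.exp_le_exp.2 (le_of_eq ?_))
    rw [hcard]
    push_cast
    ring

/-- Glasner–Weiss: Let `X` be a compact metric space and `T : X → X` a
homeomorphism. If the topological entropy of `T` (Bowen–Dinaburg entropy via dynamical
covers, w.r.t. the uniform structure of the metric — the unique one compatible with the
topology) is zero, then so is the topological entropy of the induced homeomorphism
`μ ↦ T_*μ` on the space of Borel probability measures on `X` with the weak* topology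
(a compact metrizable space), computed with respect to the unique — hence with respect to
any — uniform structure compatible with the weak* topology. -/
theorem zero_entropy_of_induced_map_on_probabilityMeasures
    {X : Type*} [MetricSpace X] [CompactSpace X] [MeasurableSpace X] [BorelSpace X]
    (T : X ≃ₜ X)
    (h : Dynamics.coverEntropy (⇑T) Set.univ ≤ 0)
    (u : UniformSpace (ProbabilityMeasure X))
    (hu : u.toTopologicalSpace
      = (inferInstance : TopologicalSpace (ProbabilityMeasure X))) :
    @Dynamics.coverEntropy (ProbabilityMeasure X) u
      (fun μ => μ.map (f := ⇑T) T.continuous.measurable.aemeasurable) Set.univ ≤ 0 := by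
  refine iSup₂_le fun U hU ↦ EReal.le_of_forall_lt_iff_le.1 fun η hη ↦ ?_
  replace hη : 0 < η := by exact_mod_cast hη
  obtain ⟨F, hF⟩ := exists_finset_forall_abs_integral_sub_lt u hu hU
  obtain ⟨C, hC⟩ : ∃ C, ∀ f ∈ F, ‖f‖ ≤ C :=
    ⟨∑ f ∈ F, ‖f‖, fun f hf ↦ Finset.single_le_sum (fun f _ ↦ norm_nonneg f) hf⟩
  let V : SetRel X X := {p | ∀ f ∈ F, |f p.1 - f p.2| ≤ 1 / 4}
  have hV : V ∈ uniformity X := by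
    have : ∀ f ∈ F, ∀ᶠ p in uniformity X, |f p.1 - f p.2| ≤ 1 / 4 := fun f _ ↦ by
      have := Metric.uniformContinuous_iff_le.1
        (CompactSpace.uniformContinuous_of_continuous f.continuous) (1 / 4) (by norm_num)
      obtain ⟨δ, hδ, hfδ⟩ := this
      exact Filter.mem_of_superset (Metric.dist_mem_uniformity hδ)
        fun p hp ↦ hfδ (le_of_lt hp)
    exact (Filter.eventually_all_finset F).2 this
  obtain ⟨L, hL⟩ := exists_nat_ge (16 * C)
  obtain ⟨a, ha, haL⟩ : ∃ a : ℝ, 0 ≤ a ∧ 2 * L * Real.exp (-a) * F.card ≤ η / 3 := by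
    have ht : Filter.Tendsto (fun a : ℝ ↦ 2 * L * Real.exp (-a) * F.card) Filter.atTop (nhds 0) := by
      simpa using ((Real.tendsto_exp_neg_atTop_nhds_zero.const_mul (2 * L : ℝ)).mul_const
        (F.card : ℝ))
    exact ((Filter.eventually_ge_atTop 0).and
      (ht.eventually_le_const (by positivity : (0 : ℝ) < η / 3))).exists
  obtain ⟨K, hK, haK⟩ : ∃ K : ℕ, K ≠ 0 ∧ a * (64 * C ^ 2 / K) * F.card ≤ η / 3 := by
    have ht : Filter.Tendsto (fun K : ℕ ↦ a * (64 * C ^ 2 / K) * F.card) Filter.atTop (nhds 0) := by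
      simpa using (((tendsto_const_div_atTop_nhds_zero_nat (64 * C ^ 2)).const_mul a).mul_const
        (F.card : ℝ))
    exact ((Filter.eventually_ne_atTop 0).and
      (ht.eventually_le_const (by positivity : (0 : ℝ) < η / 3))).exists
  have hK0 : (0 : ℝ) < K := by positivity
  have hlt : Dynamics.coverEntropyEntourage T Set.univ V < ((η / (3 * K) : ℝ) : EReal) :=
    ((Dynamics.coverEntropyEntourage_le_coverEntropy T Set.univ hV).trans h).trans_lt
      (by exact_mod_cast (by positivity : 0 < η / (3 * K)))
  refine Eventually.expGrowthSup_le ((ExpGrowth.eventually_le_exp hlt).mono fun n hn ↦ ?_)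
  have hexp : ∀ b : ℝ, EReal.exp (b * n) = ENNReal.ofReal (Real.exp (b * n)) := fun b ↦ by
    rw [← EReal.exp_coe]; push_cast; rfl
  rw [hexp] at hn ⊢
  obtain ⟨s, hs, hsn⟩ := (Dynamics.coverMincard_finite_iff T Set.univ V n).1
    (Dynamics.coverMincard_finite_of_isCompact_invariant isCompact_univ
      (Set.mapsTo_univ _ _) hV n)
  rw [← hsn, ENat.toENNReal_coe, ← ENNReal.ofReal_natCast,
    ENNReal.ofReal_le_ofReal_iff (Real.exp_pos _).le] at hn
  obtain ⟨N, hcN, hN⟩ := exists_coverMincard_map_le (V := V) T.continuous hC hF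
    (fun f hf x y hxy ↦ hxy f hf) hs hK hL ha
  refine (ENat.toENNReal_mono hcN).trans ?_
  rw [ENat.toENNReal_coe, ← ENNReal.ofReal_natCast]
  refine ENNReal.ofReal_le_ofReal (hN.trans ?_)
  refine (mul_le_mul_of_nonneg_right (pow_le_pow_left₀ (Nat.cast_nonneg _) hn K)
    (Real.exp_pos _).le).trans ?_
  rw [← Real.exp_nat_mul, ← Real.exp_add, Real.exp_le_exp]
  have h1 : (K : ℝ) * (η / (3 * K) * n) = η / 3 * n := by field_simp
  rw [h1]
  nlinarith [mul_le_mul_of_nonneg_right (add_le_add haL haK) (Nat.cast_nonneg (α := ℝ) n)]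
end

section
/- There exists a universal constant a > 0 with the following property: for all integers k ≥ 2, n ≥ 1 and every real D ≥ 1, if X is an n-dimensional complex linear subspace of the C*-algebra M_k of k × k complex matrices (equipped with the ℓ²→ℓ² operator norm), and there exists a complex-linear isomorphism Γ from X onto ℓ^n_1 (the space ℂ^n with the norm ‖c‖ = Σ_{i=1}^n |c_i|) satisfying ‖Γ‖ · ‖Γ⁻¹‖ ≤ D, then n ≤ a · D² · log k. -/
set_option synthInstance.maxHeartbeats 400000
set_option maxHeartbeats 1000000

open Finset Module

section TraceInequalities

variable {E : Type*} [NormedAddCommGroup E] [InnerProductSpace ℂ E] [FiniteDimensional ℂ E]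

theorem LinearMap.IsSymmetric.pow_apply_eigenvectorBasis {T : End ℂ E} (hT : T.IsSymmetric)
    {k : ℕ} (hk : finrank ℂ E = k) (m : ℕ) (i : Fin k) :
    (T ^ m) (hT.eigenvectorBasis hk i) =
      ((hT.eigenvalues hk i ^ m : ℝ) : ℂ) • hT.eigenvectorBasis hk i := by
  induction m with
  | zero => simp
  | succ m ih =>
    rw [pow_succ', Module.End.mul_apply, ih, map_smul, hT.apply_eigenvectorBasis, smul_smul]
    push_cast
    rw [pow_succ]
    rfl

theorem trace_pow_eq_sum_eigenvalues {T : End ℂ E} (hT : T.IsSymmetric)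
    {k : ℕ} (hk : finrank ℂ E = k) (m : ℕ) :
    LinearMap.trace ℂ E (T ^ m) = ((∑ i, hT.eigenvalues hk i ^ m : ℝ) : ℂ) := by
  rw [LinearMap.trace_eq_sum_inner _ (hT.eigenvectorBasis hk)]
  push_cast
  refine sum_congr rfl fun i _ => ?_
  rw [hT.pow_apply_eigenvectorBasis, inner_smul_right]
  simp

/-- The trace of `H W ^ l H Y ^ t` in terms of the eigenbases of `W` and `Y`. -/
theorem trace_mul_pow_mul_mul_pow {H W Y : End ℂ E} (hH : H.IsSymmetric) (hW : W.IsSymmetric)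
    (hY : Y.IsSymmetric) {k : ℕ} (hk : finrank ℂ E = k) (l t : ℕ) :
    LinearMap.trace ℂ E (H * W ^ l * H * Y ^ t) =
      ((∑ j, ∑ i, hW.eigenvalues hk i ^ l * hY.eigenvalues hk j ^ t *
        ‖inner ℂ (hW.eigenvectorBasis hk i) (H (hY.eigenvectorBasis hk j))‖ ^ 2 : ℝ) : ℂ) := by
  rw [LinearMap.trace_eq_sum_inner _ (hY.eigenvectorBasis hk)]
  push_cast
  refine sum_congr rfl fun j _ => ?_
  simp only [Module.End.mul_apply]
  rw [hY.pow_apply_eigenvectorBasis, map_smul, map_smul, map_smul, inner_smul_right, ← hH,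
    ← (hW.eigenvectorBasis hk).sum_inner_mul_inner, mul_sum]
  refine sum_congr rfl fun i _ => ?_
  rw [← hW.pow l, hW.pow_apply_eigenvectorBasis, inner_smul_left, ← inner_conj_symm (H _),
    Complex.conj_ofReal, mul_left_comm (starRingEnd ℂ _), RCLike.conj_mul]
  push_cast
  simp only [Complex.coe_algebraMap]
  ring

theorem pow_mul_pow_add_pow_mul_pow_le {a b : ℝ} {l t q : ℕ} (h : l + t = 2 * q) :
    a ^ l * b ^ t + a ^ t * b ^ l ≤ a ^ (2 * q) + b ^ (2 * q) := by
  have key : ∀ {x y : ℝ}, 0 ≤ x → 0 ≤ y →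
      x ^ l * y ^ t + x ^ t * y ^ l ≤ x ^ (l + t) + y ^ (l + t) := by
    intro x y hx hy
    have : 0 ≤ (x ^ l - y ^ l) * (x ^ t - y ^ t) := by
      rcases le_total x y with hxy | hxy
      · exact mul_nonneg_of_nonpos_of_nonpos (sub_nonpos.2 (pow_le_pow_left₀ hx hxy _))
          (sub_nonpos.2 (pow_le_pow_left₀ hx hxy _))
      · exact mul_nonneg (sub_nonneg.2 (pow_le_pow_left₀ hy hxy _))
          (sub_nonneg.2 (pow_le_pow_left₀ hy hxy _))
    rw [pow_add, pow_add]
    linarith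
  calc a ^ l * b ^ t + a ^ t * b ^ l
      ≤ |a| ^ l * |b| ^ t + |a| ^ t * |b| ^ l := by
        simp only [← abs_pow, ← abs_mul]
        exact add_le_add (le_abs_self _) (le_abs_self _)
    _ ≤ |a| ^ (l + t) + |b| ^ (l + t) := key (abs_nonneg a) (abs_nonneg b)
    _ = _ := by rw [h, (even_two_mul q).pow_abs, (even_two_mul q).pow_abs]

theorem sum_pow_mul_pow_le (a b : ℝ) (q : ℕ) :
    ∑ l ∈ range (2 * q + 1), a ^ l * b ^ (2 * q - l) ≤
      (2 * q + 1) / 2 * (a ^ (2 * q) + b ^ (2 * q)) := by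
  have hflip := sum_range_reflect (fun l => a ^ l * b ^ (2 * q - l)) (2 * q + 1)
  have hle : ∑ l ∈ range (2 * q + 1), (a ^ l * b ^ (2 * q - l) + a ^ (2 * q - l) * b ^ l) ≤
      ∑ _l ∈ range (2 * q + 1), (a ^ (2 * q) + b ^ (2 * q)) := by
    refine sum_le_sum fun l hl => pow_mul_pow_add_pow_mul_pow_le ?_
    have := mem_range.1 hl
    omega
  have hcongr : ∑ l ∈ range (2 * q + 1), a ^ (2 * q - l) * b ^ l =
      ∑ l ∈ range (2 * q + 1), a ^ l * b ^ (2 * q - l) := by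
    rw [← hflip]
    refine sum_congr rfl fun l hl => ?_
    have := mem_range.1 hl
    grind
  rw [sum_add_distrib, hcongr, sum_const, card_range, nsmul_eq_mul] at hle
  push_cast at hle
  linarith

theorem re_sum_trace_mul_pow_mul_mul_pow_le {H W Y : End ℂ E} (hH : H.IsSymmetric)
    (hW : W.IsSymmetric) (hY : Y.IsSymmetric) {s : ℝ} (hs : ∀ x, ‖H x‖ ≤ s * ‖x‖) (q : ℕ) :
    (∑ l ∈ range (2 * q + 1), LinearMap.trace ℂ E (H * W ^ l * H * Y ^ (2 * q - l))).re ≤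
      (2 * q + 1) / 2 * s ^ 2 *
        ((LinearMap.trace ℂ E (W ^ (2 * q))).re + (LinearMap.trace ℂ E (Y ^ (2 * q))).re) := by
  have hk : finrank ℂ E = finrank ℂ E := rfl
  simp only [trace_mul_pow_mul_mul_pow hH hW hY hk, trace_pow_eq_sum_eigenvalues hW hk,
    trace_pow_eq_sum_eigenvalues hY hk, Complex.re_sum, Complex.ofReal_re]
  set u := hW.eigenvectorBasis hk
  set v := hY.eigenvectorBasis hk
  set α := hW.eigenvalues hk
  set β := hY.eigenvalues hk
  set c : Fin (finrank ℂ E) → Fin (finrank ℂ E) → ℝ := fun j i => ‖inner ℂ (u i) (H (v j))‖ ^ 2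
    with hc
  have hsq : ∀ x, ‖x‖ = 1 → ‖H x‖ ^ 2 ≤ s ^ 2 := fun x hx => by
    have := hs x
    rw [hx, mul_one] at this
    exact pow_le_pow_left₀ (norm_nonneg _) this 2
  have hrow : ∀ j, ∑ i, c j i ≤ s ^ 2 := fun j => by
    simp only [hc, u.sum_sq_norm_inner_right]
    exact hsq _ (v.norm_eq_one j)
  have hcol : ∀ i, ∑ j, c j i ≤ s ^ 2 := fun i => by
    simp only [hc, ← hH (u i), v.sum_sq_norm_inner_left]
    exact hsq _ (u.norm_eq_one i)
  have heven : ∀ x : ℝ, 0 ≤ x ^ (2 * q) := fun x => (even_two_mul q).pow_nonneg x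
  calc ∑ l ∈ range (2 * q + 1), ∑ j, ∑ i, α i ^ l * β j ^ (2 * q - l) * c j i
      = ∑ j, ∑ i, (∑ l ∈ range (2 * q + 1), α i ^ l * β j ^ (2 * q - l)) * c j i := by
        rw [sum_comm]
        refine sum_congr rfl fun j _ => ?_
        rw [sum_comm]
        simp only [sum_mul]
    _ ≤ ∑ j, ∑ i, ((2 * q + 1) / 2 * (α i ^ (2 * q) + β j ^ (2 * q))) * c j i := by
        refine sum_le_sum fun j _ => sum_le_sum fun i _ => ?_
        exact mul_le_mul_of_nonneg_right (sum_pow_mul_pow_le _ _ _) (sq_nonneg _)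
    _ = (2 * q + 1) / 2 * (∑ i, α i ^ (2 * q) * ∑ j, c j i +
          ∑ j, β j ^ (2 * q) * ∑ i, c j i) := by
        simp only [mul_sum, mul_add]
        rw [sum_comm (s := univ) (f := fun i j => (2 * (q : ℝ) + 1) / 2 * (α i ^ (2 * q) * c j i)),
          ← sum_add_distrib]
        refine sum_congr rfl fun j _ => ?_
        rw [← sum_add_distrib]
        refine sum_congr rfl fun i _ => ?_
        ring
    _ ≤ (2 * q + 1) / 2 * (∑ i, α i ^ (2 * q) * s ^ 2 + ∑ j, β j ^ (2 * q) * s ^ 2) := by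
        gcongr with i _ j _
        · exact heven _
        · exact hcol i
        · exact heven _
        · exact hrow j
    _ = _ := by
        rw [← sum_mul, ← sum_mul]
        ring

theorem norm_apply_le_of_trace_pow_le {T : End ℂ E} (hT : T.IsSymmetric) {q : ℕ} (hq : q ≠ 0)
    {c : ℝ} (hc : 0 ≤ c) (h : (LinearMap.trace ℂ E (T ^ (2 * q))).re ≤ c ^ (2 * q)) (x : E) :
    ‖T x‖ ≤ c * ‖x‖ := by
  have hk : finrank ℂ E = finrank ℂ E := rfl
  rw [trace_pow_eq_sum_eigenvalues hT hk, Complex.ofReal_re] at h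
  have heig : ∀ i, hT.eigenvalues hk i ^ 2 ≤ c ^ 2 := fun i => by
    have h1 : hT.eigenvalues hk i ^ (2 * q) ≤ c ^ (2 * q) :=
      (single_le_sum (f := fun i => hT.eigenvalues hk i ^ (2 * q))
        (fun j _ => (even_two_mul q).pow_nonneg _) (mem_univ i)).trans h
    rw [pow_mul, pow_mul] at h1
    exact (pow_le_pow_iff_left₀ (sq_nonneg _) (sq_nonneg _) hq).1 h1
  refine abs_le_of_sq_le_sq' ?_ (by positivity) |>.2
  rw [mul_pow, ← (hT.eigenvectorBasis hk).sum_sq_norm_inner_right (T x),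
    ← (hT.eigenvectorBasis hk).sum_sq_norm_inner_right x, mul_sum]
  refine sum_le_sum fun i _ => ?_
  rw [← hT, hT.apply_eigenvectorBasis, inner_smul_left, norm_mul, mul_pow]
  refine mul_le_mul_of_nonneg_right ?_ (sq_nonneg _)
  simpa using heig i

end TraceInequalities

theorem sum_pow_mul_sub_mul_pow {R : Type*} [Ring R] (x y : R) (n : ℕ) :
    ∑ l ∈ range (n + 1), x ^ l * (x - y) * y ^ (n - l) = x ^ (n + 1) - y ^ (n + 1) := by
  have h := sum_range_sub (fun l => x ^ l * y ^ (n + 1 - l)) (n + 1)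
  simp only [Nat.sub_self, pow_zero, mul_one, one_mul, Nat.sub_zero] at h
  rw [← h]
  refine sum_congr rfl fun l hl => ?_
  have hl' : l ≤ n := Nat.lt_succ_iff.1 (mem_range.1 hl)
  rw [Nat.add_sub_add_right, Nat.succ_sub hl', pow_succ, pow_succ' y]
  noncomm_ring

section Khintchine

theorem LinearMap.IsSymmetric.signedSum {ι E : Type*} [Fintype ι] [NormedAddCommGroup E]
    [InnerProductSpace ℂ E] {H : ι → End ℂ E} (hH : ∀ i, (H i).IsSymmetric) (ε : ι → ℤˣ) :
    (∑ i, (ε i : ℤ) • H i).IsSymmetric := by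
  intro x y
  simp only [LinearMap.sum_apply, LinearMap.smul_apply, sum_inner, inner_sum]
  refine sum_congr rfl fun i _ => ?_
  rcases Int.units_eq_one_or (ε i) with h | h <;> simp [h, hH i x y]

variable {ι : Type*} [DecidableEq ι]

/-- Changing the sign of the coordinate `i`. -/
def flipSign (i : ι) : Equiv.Perm (ι → ℤˣ) :=
  Function.Involutive.toPerm (fun ε => Function.update ε i (-ε i)) fun ε => by simp

theorem flipSign_apply (i : ι) (ε : ι → ℤˣ) : flipSign i ε = Function.update ε i (-ε i) := rfl

theorem flipSign_apply_self (i : ι) (ε : ι → ℤˣ) : flipSign i ε i = -ε i := by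
  simp [flipSign_apply]

variable [Fintype ι]

theorem signedSum_sub_flipSign {M : Type*} [AddCommGroup M] (H : ι → M) (i : ι) (ε : ι → ℤˣ) :
    (∑ j, (ε j : ℤ) • H j) - ∑ j, (flipSign i ε j : ℤ) • H j = (2 * (ε i : ℤ)) • H i := by
  rw [← sum_sub_distrib, sum_eq_single i]
  · rw [flipSign_apply_self, ← sub_smul]
    congr 1
    push_cast
    ring
  · intro j _ hj
    simp [flipSign_apply, Function.update_of_ne hj]
  · simp

variable {E : Type*} [NormedAddCommGroup E] [InnerProductSpace ℂ E] [FiniteDimensional ℂ E]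

theorem sum_signs_trace_mul_pow_le {H : ι → End ℂ E} (hH : ∀ i, (H i).IsSymmetric) {s : ℝ}
    (hs : ∀ i x, ‖H i x‖ ≤ s * ‖x‖) (q : ℕ) (i : ι) :
    ∑ ε : ι → ℤˣ, (LinearMap.trace ℂ E
        (((ε i : ℤ) • H i) * (∑ j, (ε j : ℤ) • H j) ^ (2 * q + 1))).re ≤
      (2 * q + 1) * s ^ 2 *
        ∑ ε : ι → ℤˣ, (LinearMap.trace ℂ E ((∑ j, (ε j : ℤ) • H j) ^ (2 * q))).re := by
  set X : (ι → ℤˣ) → End ℂ E := fun ε => ∑ j, (ε j : ℤ) • H j with hX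
  set f : (ι → ℤˣ) → ℝ := fun ε =>
    (LinearMap.trace ℂ E (((ε i : ℤ) • H i) * X ε ^ (2 * q + 1))).re
  set g : (ι → ℤˣ) → ℝ := fun ε => (LinearMap.trace ℂ E (X ε ^ (2 * q))).re
  have hpair : ∀ ε, f ε + f (flipSign i ε) ≤
      (2 * q + 1) * s ^ 2 * (g ε + g (flipSign i ε)) := fun ε => by
    have hsub : ((ε i : ℤ) • H i) * X ε ^ (2 * q + 1) +
        ((flipSign i ε i : ℤ) • H i) * X (flipSign i ε) ^ (2 * q + 1) =
        (2 : ℤ) • ∑ l ∈ range (2 * q + 1),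
          H i * X ε ^ l * H i * X (flipSign i ε) ^ (2 * q - l) := by
      rw [flipSign_apply_self, Units.val_neg, neg_smul, neg_mul, ← sub_eq_add_neg, ← mul_sub,
        ← sum_pow_mul_sub_mul_pow, signedSum_sub_flipSign, mul_sum, smul_sum]
      refine sum_congr rfl fun l _ => ?_
      simp only [smul_mul_assoc, mul_smul_comm, smul_smul, ← mul_assoc]
      rw [mul_right_comm, mul_comm, mul_assoc, mul_left_comm]
      rcases Int.units_eq_one_or (ε i) with h | h <;> simp [h]
    have h := re_sum_trace_mul_pow_mul_mul_pow_le (hH i) (LinearMap.IsSymmetric.signedSum hH ε)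
      (LinearMap.IsSymmetric.signedSum hH (flipSign i ε)) (hs i) q
    simp only [f, ← Complex.add_re, ← map_add, hsub]
    rw [two_zsmul, map_add, map_sum, Complex.add_re]
    simp only [g, hX]
    linarith
  have hsum := sum_le_sum fun ε (_ : ε ∈ univ) => hpair ε
  rw [← mul_sum, sum_add_distrib, sum_add_distrib, Equiv.sum_comp (flipSign i) f,
    Equiv.sum_comp (flipSign i) g] at hsum
  linarith

/-- The moment form of the noncommutative Khintchine inequality. -/
theorem sum_signs_trace_pow_le {H : ι → End ℂ E} (hH : ∀ i, (H i).IsSymmetric) {s : ℝ}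
    (hs : ∀ i x, ‖H i x‖ ≤ s * ‖x‖) {q Q : ℕ} (hq : q ≤ Q) :
    ∑ ε : ι → ℤˣ, (LinearMap.trace ℂ E ((∑ j, (ε j : ℤ) • H j) ^ (2 * q))).re ≤
      (2 * Q * Fintype.card ι * s ^ 2) ^ q * (Fintype.card (ι → ℤˣ) * finrank ℂ E) := by
  induction q with
  | zero => simp [LinearMap.trace_one]
  | succ q ih =>
    have hstep : ∑ ε : ι → ℤˣ, (LinearMap.trace ℂ E ((∑ j, (ε j : ℤ) • H j) ^ (2 * (q + 1)))).re ≤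
        Fintype.card ι * ((2 * q + 1) * s ^ 2 *
          ∑ ε : ι → ℤˣ, (LinearMap.trace ℂ E ((∑ j, (ε j : ℤ) • H j) ^ (2 * q))).re) := by
      calc ∑ ε : ι → ℤˣ, (LinearMap.trace ℂ E ((∑ j, (ε j : ℤ) • H j) ^ (2 * (q + 1)))).re
          = ∑ i, ∑ ε : ι → ℤˣ, (LinearMap.trace ℂ E
              (((ε i : ℤ) • H i) * (∑ j, (ε j : ℤ) • H j) ^ (2 * q + 1))).re := by
            rw [sum_comm]
            refine sum_congr rfl fun ε _ => ?_
            rw [← Complex.re_sum, ← map_sum, ← sum_mul, ← pow_succ']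
            rfl
        _ ≤ _ := by
            refine (sum_le_sum fun i _ => sum_signs_trace_mul_pow_le hH hs q i).trans ?_
            rw [sum_const, card_univ, nsmul_eq_mul]
    have hqQ : (2 * q + 1 : ℝ) ≤ 2 * Q := by
      have : (q : ℝ) + 1 ≤ Q := by exact_mod_cast hq
      linarith
    have hnonneg : 0 ≤
        ∑ ε : ι → ℤˣ, (LinearMap.trace ℂ E ((∑ j, (ε j : ℤ) • H j) ^ (2 * q))).re := by
      refine sum_nonneg fun ε _ => ?_
      rw [trace_pow_eq_sum_eigenvalues (LinearMap.IsSymmetric.signedSum hH ε) rfl,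
        Complex.ofReal_re]
      exact sum_nonneg fun i _ => (even_two_mul q).pow_nonneg _
    calc _ ≤ _ := hstep
      _ = ((2 * q + 1) * Fintype.card ι * s ^ 2) *
          ∑ ε : ι → ℤˣ, (LinearMap.trace ℂ E ((∑ j, (ε j : ℤ) • H j) ^ (2 * q))).re := by ring
      _ ≤ (2 * Q * Fintype.card ι * s ^ 2) *
          ((2 * Q * Fintype.card ι * s ^ 2) ^ q * (Fintype.card (ι → ℤˣ) * finrank ℂ E)) := by
        gcongr
        exact ih (by omega)
      _ = _ := by ring

/-- Some choice of signs makes a signed sum of `n` operators of norm at most `s` small, with only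
a `dim E` factor lost in the `2 q`-th moment. -/
theorem exists_signs_norm_signedSum_le {x : ι → E →L[ℂ] E} {s : ℝ} (hs : ∀ i, ‖x i‖ ≤ s)
    {q : ℕ} (hq : q ≠ 0) {c : ℝ} (hc : 0 ≤ c)
    (h : 2 * finrank ℂ E * (2 * q * Fintype.card ι * s ^ 2) ^ q ≤ c ^ (2 * q)) :
    ∃ ε : ι → ℤˣ, ‖∑ i, (ε i : ℤ) • x i‖ ≤ 2 * c := by
  have : CompleteSpace E := FiniteDimensional.complete ℂ E
  set A : ι → E →L[ℂ] E := fun i => (realPart (x i) : E →L[ℂ] E)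
  set B : ι → E →L[ℂ] E := fun i => (imaginaryPart (x i) : E →L[ℂ] E)
  have hA : ∀ i, (A i : End ℂ E).IsSymmetric := fun i =>
    ContinuousLinearMap.isSelfAdjoint_iff_isSymmetric.1 (realPart (x i)).2
  have hB : ∀ i, (B i : End ℂ E).IsSymmetric := fun i =>
    ContinuousLinearMap.isSelfAdjoint_iff_isSymmetric.1 (imaginaryPart (x i)).2
  have hAs : ∀ i y, ‖(A i : End ℂ E) y‖ ≤ s * ‖y‖ := fun i y =>
    (A i).le_of_opNorm_le ((realPart.norm_le (x i)).trans (hs i)) y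
  have hBs : ∀ i y, ‖(B i : End ℂ E) y‖ ≤ s * ‖y‖ := fun i y =>
    (B i).le_of_opNorm_le ((imaginaryPart.norm_le (x i)).trans (hs i)) y
  have hsymA := LinearMap.IsSymmetric.signedSum hA
  have hsymB := LinearMap.IsSymmetric.signedSum hB
  set a : (ι → ℤˣ) → ℝ := fun ε =>
    (LinearMap.trace ℂ E ((∑ j, (ε j : ℤ) • (A j : End ℂ E)) ^ (2 * q))).re
  set b : (ι → ℤˣ) → ℝ := fun ε =>
    (LinearMap.trace ℂ E ((∑ j, (ε j : ℤ) • (B j : End ℂ E)) ^ (2 * q))).re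
  have hnonneg : ∀ {T : End ℂ E}, T.IsSymmetric → 0 ≤ (LinearMap.trace ℂ E (T ^ (2 * q))).re := by
    intro T hT
    rw [trace_pow_eq_sum_eigenvalues hT rfl, Complex.ofReal_re]
    exact sum_nonneg fun i _ => (even_two_mul q).pow_nonneg _
  obtain ⟨ε, -, hε⟩ : ∃ ε ∈ (univ : Finset (ι → ℤˣ)), a ε + b ε ≤ c ^ (2 * q) := by
    refine exists_le_of_sum_le univ_nonempty ?_
    rw [sum_add_distrib, sum_const, card_univ, nsmul_eq_mul]
    have h1 := sum_signs_trace_pow_le hA hAs le_rfl (q := q)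
    have h2 := sum_signs_trace_pow_le hB hBs le_rfl (q := q)
    have h3 := mul_le_mul_of_nonneg_left h (Nat.cast_nonneg (α := ℝ) (Fintype.card (ι → ℤˣ)))
    linarith
  have ha : 0 ≤ a ε := hnonneg (hsymA ε)
  have hb : 0 ≤ b ε := hnonneg (hsymB ε)
  refine ⟨ε, ContinuousLinearMap.opNorm_le_bound _ (by positivity) fun y => ?_⟩
  have hsplit : (∑ i, (ε i : ℤ) • x i) y = (∑ i, (ε i : ℤ) • (A i : End ℂ E)) y +
      Complex.I • (∑ i, (ε i : ℤ) • (B i : End ℂ E)) y := by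
    simp only [_root_.sum_apply, LinearMap.sum_apply, smul_sum, ← sum_add_distrib]
    refine sum_congr rfl fun i _ => ?_
    have hx : x i y = A i y + Complex.I • B i y := by
      conv_lhs => rw [← realPart_add_I_smul_imaginaryPart (x i)]
      rfl
    rcases Int.units_eq_one_or (ε i) with h | h <;> simp [h, hx, add_comm]
  have hAy := norm_apply_le_of_trace_pow_le (hsymA ε) hq hc (by linarith) y
  have hBy := norm_apply_le_of_trace_pow_le (hsymB ε) hq hc (by linarith) y
  rw [hsplit]
  refine (norm_add_le _ _).trans ?_
  rw [norm_smul, Complex.norm_I, one_mul]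
  linarith

end Khintchine

/-- key geometric proposition: There is a universal constant `a > 0` such that
for all `k ≥ 2`, `n ≥ 1` and `D ≥ 1`: if `X` is an `n`-dimensional complex linear subspace of
the C*-algebra `M_k` of `k × k` complex matrices with the `ℓ² → ℓ²` operator norm — realized
here as the algebra of (automatically bounded) operators on `ℓ²_k = ℂ^k` — and `Γ : X → ℓ¹_n`
is a complex-linear isomorphism onto `ℓ¹_n = (ℂ^n, ‖c‖ = ∑ |c_i|)` with `‖Γ‖ · ‖Γ⁻¹‖ ≤ D`
(expressed via constants `r, s` bounding the norms of `Γ` and `Γ⁻¹` with `r · s ≤ D`), then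
`n ≤ a · D² · log k`. -/
theorem ell1_subspace_of_matrix_algebra_dim_bound :
    ∃ a : ℝ, 0 < a ∧
      ∀ (k n : ℕ), 2 ≤ k → 1 ≤ n → ∀ D : ℝ, 1 ≤ D →
        ∀ X : Submodule ℂ (EuclideanSpace ℂ (Fin k) →L[ℂ] EuclideanSpace ℂ (Fin k)),
          Module.finrank ℂ X = n →
          ∀ Γ : X ≃ₗ[ℂ] PiLp 1 (fun _ : Fin n => ℂ),
            ∀ r s : ℝ,
              (∀ v : X, ‖Γ v‖ ≤ r * ‖v‖) →
              (∀ w : PiLp 1 (fun _ : Fin n => ℂ), ‖Γ.symm w‖ ≤ s * ‖w‖) →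
              r * s ≤ D →
              (n : ℝ) ≤ a * D ^ 2 * Real.log k := by
  refine ⟨300, by norm_num, fun k n hk hn D hD X _ Γ r s hr hs hrs => ?_⟩
  by_contra! hlt
  let y : Fin n → X := fun i => Γ.symm (PiLp.single 1 i 1)
  have hy : ∀ i, ‖y i‖ ≤ s := fun i => by
    simpa [PiLp.norm_single] using hs (PiLp.single 1 i 1)
  have hΓy : ∀ i, Γ (y i) = PiLp.single 1 i 1 := fun i => Γ.apply_symm_apply _
  have hr0 : 0 < r := by
    have h := hr (y ⟨0, hn⟩)
    rw [hΓy, PiLp.norm_single, norm_one] at h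
    exact pos_of_mul_pos_left (zero_lt_one.trans_le h) (norm_nonneg (y ⟨0, hn⟩))
  have hs0 : 0 ≤ s := (norm_nonneg (y ⟨0, hn⟩)).trans (hy ⟨0, hn⟩)
  have hn0 : (0 : ℝ) < n := by exact_mod_cast hn
  have hk0 : (0 : ℝ) < k := by positivity
  have hlog : 1 / 2 ≤ Real.log k := by
    have h := Real.log_le_log two_pos (show (2 : ℝ) ≤ k by exact_mod_cast hk)
    linarith [Real.log_two_gt_d9]
  set q := ⌈Real.log k⌉₊
  have hq0 : q ≠ 0 := (Nat.ceil_pos.2 (by linarith)).ne'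
  have hq3 : (q : ℝ) ≤ 3 * Real.log k := by
    linarith [Nat.ceil_lt_add_one (show 0 ≤ Real.log k by linarith)]
  have hkq : (k : ℝ) ≤ Real.exp 1 ^ q := by
    rw [← Real.exp_nat_mul, mul_one, ← Real.log_le_iff_le_exp hk0]
    exact Nat.le_ceil _
  have hbase : 2 * Real.exp 1 * (2 * q * n * s ^ 2) ≤ (n / (3 * r)) ^ 2 := by
    rw [div_pow, le_div_iff₀ (by positivity)]
    have h1 : (r * s) ^ 2 ≤ D ^ 2 := pow_le_pow_left₀ (by positivity) hrs 2
    have h2 : 36 * Real.exp 1 * q * (r * s) ^ 2 ≤ n := by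
      calc 36 * Real.exp 1 * q * (r * s) ^ 2
          ≤ 36 * (25 / 9) * (3 * Real.log k) * D ^ 2 := by
            gcongr
            linarith [Real.exp_one_lt_d9]
        _ = 300 * D ^ 2 * Real.log k := by ring
        _ ≤ n := hlt.le
    calc 2 * Real.exp 1 * (2 * q * n * s ^ 2) * (3 * r) ^ 2
        = (n : ℝ) * (36 * Real.exp 1 * q * (r * s) ^ 2) := by ring
      _ ≤ (n : ℝ) * n := by gcongr
      _ = (n : ℝ) ^ 2 := by ring
  obtain ⟨ε, hε⟩ := exists_signs_norm_signedSum_le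
    (x := fun i => (y i : EuclideanSpace ℂ (Fin k) →L[ℂ] EuclideanSpace ℂ (Fin k))) hy hq0
    (c := n / (3 * r)) (by positivity) (by
      rw [finrank_euclideanSpace_fin, Fintype.card_fin, pow_mul]
      calc 2 * (k : ℝ) * (2 * q * n * s ^ 2) ^ q
          ≤ 2 ^ q * Real.exp 1 ^ q * (2 * q * n * s ^ 2) ^ q := by
            gcongr
            exact le_self_pow₀ one_le_two hq0
        _ = (2 * Real.exp 1 * (2 * q * n * s ^ 2)) ^ q := by rw [← mul_pow, ← mul_pow]
        _ ≤ _ := by gcongr)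
  have hΓsum : Γ (∑ i, (ε i : ℤ) • y i) = ∑ i, (ε i : ℤ) • PiLp.single 1 i 1 := by
    rw [map_sum]
    exact sum_congr rfl fun i _ => (map_zsmul Γ _ _).trans (by rw [hΓy])
  have hnorm : ‖Γ (∑ i, (ε i : ℤ) • y i)‖ = n := by
    have hcoord : ∀ j, ‖(Γ (∑ i, (ε i : ℤ) • y i)) j‖ = 1 := fun j => by
      have : (Γ (∑ i, (ε i : ℤ) • y i)) j = ((ε j : ℤ) : ℂ) := by
        simp [hΓsum, Pi.single_apply]
      rw [this]
      rcases Int.units_eq_one_or (ε j) with h | h <;> simp [h]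
    simp only [PiLp.norm_eq_of_L1, hcoord, sum_const, card_univ, Fintype.card_fin, nsmul_eq_mul,
      mul_one]
  have h := hr (∑ i, (ε i : ℤ) • y i)
  have hcoe : ‖∑ i, (ε i : ℤ) • y i‖ ≤ 2 * (n / (3 * r)) := by
    refine le_of_eq_of_le ?_ hε
    rw [X.coe_norm, X.coe_sum]
    rfl
  rw [hnorm] at h
  have h' := h.trans (mul_le_mul_of_nonneg_left hcoe hr0.le)
  have : r * (2 * (n / (3 * r))) = 2 / 3 * n := by field_simp
  linarith
end

section
/- Let X be a nonempty compact metrizable, totally disconnected, perfect topological space (a Cantor set) and T : X → X a homeomorphism. Then the topological entropy of T is strictly positive if and only if there exist a continuous function f : X → ℝ and, for each n ∈ ℕ, a subset I_n ⊆ {0, 1, …, n−1}, with limsup_{n→∞} |I_n|/n > 0, such that for each n the family {f ∘ T^k : k ∈ I_n} forms a standard basis of a copy of real ℓ^{I_n}_1 inside C(X, ℝ): that is, for all real coefficients (c_k)_{k ∈ I_n}, the supremum norm satisfies ‖Σ_{k ∈ I_n} c_k · (f ∘ T^k)‖_∞ = Σ_{k ∈ I_n} |c_k|. -/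
open Finset
open Filter Topology Uniformity

section HittingTimes

open Classical in
/-- The times `k < n` at which the orbit of `x` under `T` visits `A`. -/
noncomputable def hittingTimes {X : Type*} (T : X → X) (A : Set X) (n : ℕ) (x : X) : Finset ℕ :=
  {k ∈ range n | T^[k] x ∈ A}

open Classical in
/-- The family of all sets of hitting times of `A` before time `n` realised by some orbit. -/
noncomputable def hittingFamily {X : Type*} (T : X → X) (A : Set X) (n : ℕ) :
    Finset (Finset ℕ) :=
  {s ∈ (range n).powerset | ∃ x, hittingTimes T A n x = s}

variable {X : Type*} {T : X → X} {A : Set X} {n k : ℕ} {x : X} {s : Finset ℕ}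

lemma mem_hittingTimes : k ∈ hittingTimes T A n x ↔ k < n ∧ T^[k] x ∈ A := by
  simp [hittingTimes]

lemma hittingTimes_subset_range : hittingTimes T A n x ⊆ range n := by
  classical exact filter_subset _ _

lemma mem_hittingFamily : s ∈ hittingFamily T A n ↔ ∃ x, hittingTimes T A n x = s := by
  simp only [hittingFamily, mem_filter, mem_powerset, and_iff_right_iff_imp]
  rintro ⟨x, rfl⟩
  exact hittingTimes_subset_range

lemma hittingFamily_nonempty [Nonempty X] : (hittingFamily T A n).Nonempty :=
  ⟨_, mem_hittingFamily.2 ⟨Classical.arbitrary X, rfl⟩⟩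

lemma subset_range_of_shatters_hittingFamily (h : (hittingFamily T A n).Shatters s) :
    s ⊆ range n := by
  obtain ⟨u, hu, hsu⟩ := h.exists_superset
  obtain ⟨x, rfl⟩ := mem_hittingFamily.1 hu
  exact hsu.trans hittingTimes_subset_range

/-- If the squares of the sets of a cover lie in the entourage `U`, the number of `U`-dynamical
balls needed to cover the space is at most the product of the numbers of hitting patterns. -/
lemma coverMincard_le_prod_card_hittingFamily [Nonempty X] {ι : Type*} [Fintype ι]
    {V : ι → Set X} (U : SetRel X X) (hV : ∀ j, V j ×ˢ V j ⊆ U) (hcover : ⋃ j, V j = Set.univ)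
    (n : ℕ) :
    Dynamics.coverMincard T Set.univ U n ≤ (∏ j, #(hittingFamily T (V j) n) : ℕ) := by
  classical
  let code : X → ι → Finset ℕ := fun x j ↦ hittingTimes T (V j) n x
  let N : Finset X :=
    (Fintype.piFinset fun j ↦ hittingFamily T (V j) n).image (Function.invFun code)
  have hN : Dynamics.IsDynCoverOf T Set.univ U n N := by
    intro x _
    have hx : code (Function.invFun code (code x)) = code x := Function.invFun_eq ⟨x, rfl⟩
    refine ⟨Function.invFun code (code x), ?_, ?_⟩
    · refine mem_coe.2 (mem_image_of_mem _ (Fintype.mem_piFinset.2 fun j ↦ ?_))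
      exact mem_hittingFamily.2 ⟨x, rfl⟩
    · refine Dynamics.mem_dynEntourage.2 fun k hk ↦ ?_
      obtain ⟨j, hj⟩ := Set.mem_iUnion.1 (hcover.symm ▸ Set.mem_univ (T^[k] x))
      have hkx : k ∈ code x j := mem_hittingTimes.2 ⟨hk, hj⟩
      rw [← hx] at hkx
      exact hV j ⟨hj, (mem_hittingTimes.1 hkx).2⟩
  refine hN.coverMincard_le_card.trans ?_
  rw [← Fintype.card_piFinset]
  exact_mod_cast card_image_le

end HittingTimes

/-- A weighted form of the Sauer–Shelah lemma. -/
lemma exists_shatters_card_mul_pow_le {α : Type*} [DecidableEq α] {𝒜 : Finset (Finset α)}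
    (hne : 𝒜.Nonempty) {S : Finset α} (hS : ∀ t ∈ 𝒜, t ⊆ S) {x : ℝ} (hx₀ : 0 < x)
    (hx₁ : x ≤ 1) : ∃ t, 𝒜.Shatters t ∧ #𝒜 * x ^ #t ≤ (1 + x) ^ #S := by
  obtain ⟨t, ht, hmax⟩ := exists_max_image 𝒜.shatterer card
    ⟨∅, mem_shatterer.2 (shatters_empty.2 hne)⟩
  refine ⟨t, mem_shatterer.1 ht, ?_⟩
  have hsub : 𝒜.shatterer ⊆ S.powerset := fun u hu ↦ by
    obtain ⟨v, hv, huv⟩ := (mem_shatterer.1 hu).exists_superset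
    exact mem_powerset.2 (huv.trans (hS v hv))
  calc (#𝒜 : ℝ) * x ^ #t ≤ #𝒜.shatterer * x ^ #t := by
        exact mul_le_mul_of_nonneg_right (by exact_mod_cast card_le_card_shatterer 𝒜)
          (by positivity)
    _ = ∑ _u ∈ 𝒜.shatterer, x ^ #t := by simp
    _ ≤ ∑ u ∈ 𝒜.shatterer, x ^ #u :=
        sum_le_sum fun u hu ↦ pow_le_pow_of_le_one hx₀.le hx₁ (hmax u hu)
    _ ≤ ∑ u ∈ S.powerset, x ^ #u :=
        sum_le_sum_of_subset_of_nonneg hsub fun u _ _ ↦ by positivity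
    _ = (1 + x) ^ #S := by
        rw [← prod_const, prod_one_add]
        simp

/-- A family of subsets of a set of size `n` with at least `exp (β n)` members shatters a set
of size at least `β² n / 4`. -/
lemma exists_shatters_of_exp_le_card {α : Type*} [DecidableEq α] {𝒜 : Finset (Finset α)}
    {S : Finset α} (hS : ∀ t ∈ 𝒜, t ⊆ S) {β : ℝ} (hβ : 0 < β)
    (h : Real.exp (β * #S) ≤ #𝒜) : ∃ t, 𝒜.Shatters t ∧ β ^ 2 / 4 * #S ≤ #t := by
  have hne : 𝒜.Nonempty := card_pos.1 (by exact_mod_cast (Real.exp_pos _).trans_le h)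
  have hx : Real.exp (-(2 / β)) ≤ β / 2 := by
    rw [Real.exp_neg, inv_le_comm₀ (Real.exp_pos _) (by positivity), inv_div]
    linarith [Real.add_one_le_exp (2 / β)]
  obtain ⟨t, ht, hle⟩ := exists_shatters_card_mul_pow_le hne hS (Real.exp_pos (-(2 / β)))
    (Real.exp_le_one_iff.2 (by simp; positivity))
  refine ⟨t, ht, ?_⟩
  have key : Real.exp (β * #S + #t * (-(2 / β))) ≤ Real.exp (#S * (β / 2)) := by
    rw [Real.exp_add, Real.exp_nat_mul, Real.exp_nat_mul]
    calc _ ≤ #𝒜 * Real.exp (-(2 / β)) ^ #t := by gcongr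
      _ ≤ _ := hle
      _ ≤ _ := by
        gcongr
        linarith [Real.add_one_le_exp (β / 2)]
  have hlin := Real.exp_le_exp.1 key
  have hmul : β * #S / 2 ≤ #t * (2 / β) := by linarith
  rw [mul_div_assoc', le_div_iff₀ hβ] at hmul
  linarith

lemma sum_eq_card_iff_of_le_one {ι : Type*} {s : Finset ι} {v : ι → ℝ} (hv : ∀ i ∈ s, v i ≤ 1) :
    ∑ i ∈ s, v i = #s ↔ ∀ i ∈ s, v i = 1 := by
  have := sum_eq_sum_iff_of_le hv
  simpa using this

section Norm

variable {X : Type*} [TopologicalSpace X]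

/-- The continuous function equal to `1` on a clopen set and to `-1` off it. -/
noncomputable def clopenSign {A : Set X} (hA : IsClopen A) : C(X, ℝ) :=
  (2 : ℝ) • (LocallyConstant.charFn ℝ hA : C(X, ℝ)) - 1

lemma clopenSign_of_mem {A : Set X} (hA : IsClopen A) {x : X} (hx : x ∈ A) :
    clopenSign hA x = 1 := by
  have := (LocallyConstant.charFn_eq_one (Y := ℝ) x hA).2 hx
  simp [clopenSign, this]
  norm_num

lemma clopenSign_of_notMem {A : Set X} (hA : IsClopen A) {x : X} (hx : x ∉ A) :
    clopenSign hA x = -1 := by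
  have := (LocallyConstant.charFn_eq_zero (Y := ℝ) x hA).2 hx
  simp [clopenSign, this]

variable [CompactSpace X]

lemma norm_sum_clopenSign_comp_of_shatters {T : X → X} (hT : Continuous T) {A : Set X}
    (hA : IsClopen A) {n : ℕ} {s : Finset ℕ} (hs : (hittingFamily T A n).Shatters s)
    (c : ℕ → ℝ) :
    ‖∑ k ∈ s, c k • (clopenSign hA).comp ⟨T^[k], hT.iterate k⟩‖ = ∑ k ∈ s, |c k| := by
  apply le_antisymm
  · refine (ContinuousMap.norm_le _ (sum_nonneg fun k _ ↦ abs_nonneg (c k))).2 fun x ↦ ?_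
    rw [ContinuousMap.sum_apply]
    refine (norm_sum_le _ _).trans (sum_le_sum fun k _ ↦ ?_)
    by_cases hx : T^[k] x ∈ A
    · simp [clopenSign_of_mem hA hx]
    · simp [clopenSign_of_notMem hA hx]
  · obtain ⟨u, hu, hsu⟩ := hs (filter_subset (fun k ↦ 0 ≤ c k) s)
    obtain ⟨x, rfl⟩ := mem_hittingFamily.1 hu
    refine le_trans (le_of_eq ?_) ((Real.le_norm_self _).trans (ContinuousMap.norm_coe_le_norm _ x))
    rw [ContinuousMap.sum_apply]
    refine sum_congr rfl fun k hk ↦ ?_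
    have hkn : k < n := mem_range.1 (subset_range_of_shatters_hittingFamily hs hk)
    have hiff : T^[k] x ∈ A ↔ 0 ≤ c k := by
      have := congr_arg (k ∈ ·) hsu
      simpa [mem_hittingTimes, hk, hkn] using this
    by_cases hx : T^[k] x ∈ A
    · simp [clopenSign_of_mem hA hx, abs_of_nonneg (hiff.1 hx)]
    · simp [clopenSign_of_notMem hA hx, abs_of_neg (not_le.1 (mt hiff.2 hx))]

/-- The norm of a continuous function on a nonempty compact space is attained. -/
lemma ContinuousMap.exists_abs_apply_eq_norm [Nonempty X] (g : C(X, ℝ)) : ∃ x, |g x| = ‖g‖ := by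
  obtain ⟨x, -, hx⟩ := isCompact_univ.exists_isMaxOn (Set.univ_nonempty (α := X))
    (f := fun x ↦ |g x|) (by fun_prop)
  exact ⟨x, le_antisymm (g.norm_coe_le_norm x)
    ((g.norm_le (abs_nonneg _)).2 fun y ↦ hx (Set.mem_univ y))⟩

/-- If the functions `f ∘ T^k`, `k ∈ s`, span `ℓ¹` isometrically, then every sign pattern on `s`
is realised, up to a global sign, by the values of `f` along an orbit. -/
lemma exists_forall_mul_apply_iterate_eq [Nonempty X] {T : X → X} (hT : Continuous T)
    {f : C(X, ℝ)} (hf : ∀ x, |f x| ≤ 1) {s : Finset ℕ} {ε : ℕ → ℝ} (hε : ∀ k, |ε k| = 1)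
    (h : ‖∑ k ∈ s, ε k • f.comp ⟨T^[k], hT.iterate k⟩‖ = ∑ k ∈ s, |ε k|) :
    ∃ (x : X) (σ : ℝ), (σ = 1 ∨ σ = -1) ∧ ∀ k ∈ s, ε k * f (T^[k] x) = σ := by
  obtain ⟨x, hx⟩ := ContinuousMap.exists_abs_apply_eq_norm
    (∑ k ∈ s, ε k • f.comp ⟨T^[k], hT.iterate k⟩)
  rw [h, ContinuousMap.sum_apply] at hx
  simp only [hε, sum_const, nsmul_eq_mul, mul_one, ContinuousMap.coe_smul, Pi.smul_apply,
    ContinuousMap.comp_apply, ContinuousMap.coe_mk, smul_eq_mul] at hx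
  have hv : ∀ k ∈ s, |ε k * f (T^[k] x)| ≤ 1 := fun k _ ↦ by
    rw [abs_mul, hε, one_mul]
    exact hf _
  rcases abs_choice (∑ k ∈ s, ε k * f (T^[k] x)) with h' | h' <;> rw [h'] at hx
  · exact ⟨x, 1, Or.inl rfl,
      (sum_eq_card_iff_of_le_one fun k hk ↦ (abs_le.1 (hv k hk)).2).1 hx⟩
  · rw [← sum_neg_distrib] at hx
    refine ⟨x, -1, Or.inr rfl, fun k hk ↦ ?_⟩
    have := (sum_eq_card_iff_of_le_one fun k hk ↦ by
      linarith [(abs_le.1 (hv k hk)).1]).1 hx k hk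
    linarith

/-- An isometric copy of `ℓ¹_s` spanned by `f ∘ T^k`, `k ∈ s`, yields `2 ^ (#s - 1)` separated
orbits. -/
lemma two_pow_le_netMaxcard [Nonempty X] {T : X → X} (hT : Continuous T)
    (hsurj : Function.Surjective T) {f : C(X, ℝ)} {n : ℕ} {s : Finset ℕ} (hsn : s ⊆ range n)
    (hs : s.Nonempty)
    (h : ∀ c : ℕ → ℝ,
      ‖∑ k ∈ s, c k • f.comp ⟨T^[k], hT.iterate k⟩‖ = ∑ k ∈ s, |c k|) :
    (2 ^ (#s - 1) : ℕ) ≤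
      Dynamics.netMaxcard T Set.univ {p | dist (f p.1) (f p.2) < 1} n := by
  classical
  obtain ⟨k₀, hk₀⟩ := hs
  have hf : ∀ y, |f y| ≤ 1 := fun y ↦ by
    obtain ⟨x, rfl⟩ := hsurj.iterate k₀ y
    have hnorm := h (Pi.single k₀ 1)
    rw [sum_eq_single_of_mem k₀ hk₀ fun k _ hk ↦ by simp [hk],
      sum_eq_single_of_mem k₀ hk₀ fun k _ hk ↦ by simp [hk]] at hnorm
    simp only [Pi.single_eq_same, one_smul, abs_one] at hnorm
    exact hnorm ▸ ContinuousMap.norm_coe_le_norm (f.comp ⟨T^[k₀], hT.iterate k₀⟩) x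
  let ε : Finset ℕ → ℕ → ℝ := fun t k ↦ if k ∈ t then -1 else 1
  have hε : ∀ t k, |ε t k| = 1 := fun t k ↦ by
    by_cases hk : k ∈ t <;> simp [ε, hk]
  choose x σ hσ hx using fun t ↦ exists_forall_mul_apply_iterate_eq hT hf (hε t) (h (ε t))
  have hsep : ∀ t ⊆ s.erase k₀, ∀ t' ⊆ s.erase k₀,
      (∀ k ∈ s, dist (f (T^[k] (x t))) (f (T^[k] (x t'))) < 2) → t = t' := by
    intro t ht t' ht' hclose
    have hsigns : σ t = σ t' := by
      have h₁ := hx t k₀ hk₀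
      have h₂ := hx t' k₀ hk₀
      have h₃ := abs_lt.1 (hclose k₀ hk₀)
      have hn : k₀ ∉ t := fun hk ↦ notMem_erase _ _ (ht hk)
      have hn' : k₀ ∉ t' := fun hk ↦ notMem_erase _ _ (ht' hk)
      simp only [ε, hn, hn', if_false, one_mul] at h₁ h₂
      rcases hσ t with e | e <;> rcases hσ t' with e' | e' <;> rw [e] at h₁ <;>
        rw [e'] at h₂ <;> rw [e, e'] <;> linarith
    ext k
    by_cases hk : k ∈ s
    · have h₁ := hx t k hk
      have h₂ := hx t' k hk
      have h₃ := abs_lt.1 (hclose k hk)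
      rw [← hsigns] at h₂
      by_cases hkt : k ∈ t <;> by_cases hkt' : k ∈ t' <;> simp only [ε, hkt, hkt', if_true,
        if_false] at h₁ h₂ ⊢ <;> rcases hσ t with e | e <;> rw [e] at h₁ h₂ <;> linarith
    · exact ⟨fun hkt ↦ absurd (mem_of_mem_erase (ht hkt)) hk,
        fun hkt ↦ absurd (mem_of_mem_erase (ht' hkt)) hk⟩
  have hinj : Set.InjOn x ((s.erase k₀).powerset : Set (Finset ℕ)) := by
    intro t ht t' ht' htt'
    refine hsep t (mem_powerset.1 ht) t' (mem_powerset.1 ht') fun k _ ↦ ?_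
    rw [htt', dist_self]
    norm_num
  have hnet : Dynamics.IsDynNetIn T Set.univ {p | dist (f p.1) (f p.2) < 1} n
      ((s.erase k₀).powerset.image x : Finset X) := by
    refine ⟨Set.subset_univ _, ?_⟩
    rw [coe_image]
    rintro _ ⟨t, ht, rfl⟩ _ ⟨t', ht', rfl⟩ hne
    refine Set.disjoint_left.2 fun z hz hz' ↦ hne (congr_arg x ?_)
    refine hsep t (mem_powerset.1 ht) t' (mem_powerset.1 ht') fun k hk ↦ ?_
    have hkn := mem_range.1 (hsn hk)
    have h₁ : dist (f (T^[k] (x t))) (f (T^[k] z)) < 1 :=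
      Dynamics.mem_dynEntourage.1 hz k hkn
    have h₂ : dist (f (T^[k] (x t'))) (f (T^[k] z)) < 1 :=
      Dynamics.mem_dynEntourage.1 hz' k hkn
    linarith [dist_triangle_right (f (T^[k] (x t))) (f (T^[k] (x t'))) (f (T^[k] z))]
  have := hnet.card_le_netMaxcard
  rwa [card_image_of_injOn hinj, card_powerset, card_erase_of_mem hk₀] at this

end Norm

section Entropy

variable {X : Type*} [MetricSpace X] [CompactSpace X] [Nonempty X]

lemma isBoundedUnder_card_div {I : ℕ → Finset ℕ} (hI : ∀ n, I n ⊆ range n) :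
    IsBoundedUnder (· ≤ ·) atTop fun n ↦ ((I n).card : ℝ) / (n : ℝ) := by
  refine isBoundedUnder_of ⟨1, fun n ↦ div_le_one_of_le₀ ?_ n.cast_nonneg⟩
  simpa using card_le_card (hI n)

/-- In a totally disconnected space, positive entropy produces a clopen set with exponentially
many hitting patterns. -/
lemma exists_isClopen_frequently_exp_le_card_hittingFamily [TotallyDisconnectedSpace X]
    {T : X → X} (h : 0 < Dynamics.coverEntropy T Set.univ) :
    ∃ A : Set X, IsClopen A ∧ ∃ β : ℝ, 0 < β ∧
      ∃ᶠ n : ℕ in atTop, Real.exp (β * n) ≤ #(hittingFamily T A n) := by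
  simp only [Dynamics.coverEntropy, lt_iSup_iff] at h
  obtain ⟨U, hU, hpos⟩ := h
  obtain ⟨b, hb₀, hb⟩ := EReal.lt_iff_exists_real_btwn.1 hpos
  have hb₀' : 0 < b := by exact_mod_cast hb₀
  obtain ⟨δ, hδ, hδU⟩ := Metric.mem_uniformity_dist.1 hU
  obtain ⟨r, V, hVsub, hVcover⟩ :=
    (TopologicalSpace.IsOpenCover.of_sets (v := fun x : X ↦ Metric.ball x (δ / 2))
      (fun _ ↦ Metric.isOpen_ball)
      (Set.eq_univ_of_forall fun x ↦ Set.mem_iUnion.2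
        ⟨x, Metric.mem_ball_self (half_pos hδ)⟩)).exists_finite_clopen_cover
  have hVU : ∀ j, (V j : Set X) ×ˢ (V j : Set X) ⊆ U := by
    rintro j ⟨y, z⟩ ⟨hy, hz⟩
    obtain ⟨x, hx⟩ := hVsub j
    have hy' : dist y x < δ / 2 := hx hy
    have hz' : dist z x < δ / 2 := hx hz
    exact hδU (by linarith [dist_triangle_right y z x])
  have hr : 0 < r := by
    obtain ⟨j, -⟩ := Set.mem_iUnion.1 (hVcover (Set.mem_univ (Classical.arbitrary X)))
    exact j.pos
  have hr' : (0 : ℝ) < r := by exact_mod_cast hr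
  have hfreq : ∃ᶠ n : ℕ in atTop, ∃ j,
      Real.exp (b / r * n) ≤ #(hittingFamily T (V j : Set X) n) := by
    refine (ExpGrowth.frequently_exp_le hb).mono fun n hn ↦ ?_
    have hle : Real.exp (b * n) ≤ ∏ j, (#(hittingFamily T (V j : Set X) n) : ℝ) := by
      have hn' := hn.trans (ENat.toENNReal_mono (coverMincard_le_prod_card_hittingFamily U hVU
        (Set.univ_subset_iff.1 hVcover) n))
      rw [← EReal.coe_coe_eq_natCast, ← EReal.coe_mul, EReal.exp_coe, ENat.toENNReal_coe,
        ENNReal.ofReal_le_natCast] at hn'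
      exact_mod_cast hn'
    by_contra! hlt
    have : Nonempty (Fin r) := ⟨⟨0, hr⟩⟩
    refine absurd hle (not_le.2 ?_)
    calc ∏ j, (#(hittingFamily T (V j : Set X) n) : ℝ)
        < ∏ _j : Fin r, Real.exp (b / r * n) :=
          prod_lt_prod_of_nonempty
            (fun j _ ↦ by exact_mod_cast card_pos.2 hittingFamily_nonempty)
            (fun j _ ↦ hlt j) univ_nonempty
      _ = Real.exp (b * n) := by
          rw [prod_const, card_univ, Fintype.card_fin, ← Real.exp_nat_mul]
          congr 1
          field_simp
  obtain ⟨j, hj⟩ := frequently_exists.1 hfreq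
  exact ⟨V j, (V j).isClopen, b / r, by positivity, hj⟩

lemma coverEntropy_pos_of_norm_sum_eq {T : X → X} (hT : Continuous T)
    (hsurj : Function.Surjective T) {f : C(X, ℝ)} {I : ℕ → Finset ℕ}
    (hI : ∀ n, I n ⊆ range n) (hlim : 0 < atTop.limsup fun n ↦ ((I n).card : ℝ) / (n : ℝ))
    (h : ∀ (n : ℕ) (c : ℕ → ℝ),
      ‖∑ k ∈ I n, c k • f.comp ⟨T^[k], hT.iterate k⟩‖ = ∑ k ∈ I n, |c k|) :
    0 < Dynamics.coverEntropy T Set.univ := by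
  obtain ⟨a, ha₀, ha⟩ := exists_between hlim
  have hfreq := frequently_lt_of_lt_limsup
    (IsCoboundedUnder.of_frequently_ge
      (Frequently.of_forall fun n : ℕ ↦ show (0 : ℝ) ≤ (#(I n) : ℝ) / n by positivity)) ha
  have hU : {p : X × X | dist (f p.1) (f p.2) < 1} ∈ 𝓤 X :=
    (CompactSpace.uniformContinuous_of_continuous f.continuous) (Metric.dist_mem_uniformity one_pos)
  have hgrowth : ((a / 2 * Real.log 2 : ℝ) : EReal) ≤
      Dynamics.netEntropyEntourage T Set.univ {p : X × X | dist (f p.1) (f p.2) < 1} := by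
    refine Frequently.le_expGrowthSup ((hfreq.and_eventually
      (eventually_ge_atTop (⌈2 / a⌉₊ + 1))).mono ?_)
    rintro n ⟨hn, hlarge⟩
    have hn₀ : (0 : ℝ) < n := by exact_mod_cast (Nat.succ_pos _).trans_le hlarge
    have hcard : a * n < #(I n) := (lt_div_iff₀ hn₀).1 hn
    have hIne : (I n).Nonempty :=
      card_pos.1 (by exact_mod_cast (by positivity : 0 < a * n).trans hcard)
    have han : 2 ≤ a * n := by
      have h₁ : 2 / a ≤ n := (Nat.le_ceil _).trans (by exact_mod_cast (Nat.le_succ _).trans hlarge)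
      rwa [div_le_iff₀' ha₀] at h₁
    have hnet := ENat.toENNReal_mono (two_pow_le_netMaxcard hT hsurj (hI n) hIne (h n))
    refine le_trans ?_ hnet
    rw [← EReal.coe_coe_eq_natCast, ← EReal.coe_mul, EReal.exp_coe, ENat.toENNReal_coe,
      ENNReal.ofReal_le_natCast]
    calc Real.exp (a / 2 * Real.log 2 * n)
        ≤ Real.exp ((#(I n) - 1 : ℕ) * Real.log 2) := by
          rw [Nat.cast_sub hIne.card_pos, Nat.cast_one, mul_right_comm]
          gcongr
          linarith
      _ = ((2 ^ (#(I n) - 1) : ℕ) : ℝ) := by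
          rw [Real.exp_nat_mul, Real.exp_log two_pos]
          norm_cast
  have hpos : (0 : EReal) < ((a / 2 * Real.log 2 : ℝ) : EReal) := by
    have := Real.log_pos one_lt_two
    exact_mod_cast (by positivity : 0 < a / 2 * Real.log 2)
  exact hpos.trans_le (hgrowth.trans (Dynamics.netEntropyEntourage_le_coverEntropy T Set.univ hU))

end Entropy

/-- Let `X` be a (nonempty) Cantor set — a nonempty compact metrizable, totally
disconnected, perfect space, here carrying a compatible metric — and `T : X → X` a
homeomorphism. Then the topological entropy of `T` (Bowen–Dinaburg entropy via dynamical
covers, w.r.t. the unique uniform structure compatible with the topology, i.e. that of the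
metric) is strictly positive if and only if there exist a continuous `f : X → ℝ` and subsets
`I_n ⊆ {0, …, n-1}` with `limsup |I_n|/n > 0` such that for each `n` the family
`{f ∘ T^k : k ∈ I_n}` is a standard basis of a copy of real `ℓ¹_{I_n}` in `C(X, ℝ)`:
`‖∑_{k ∈ I_n} c_k · (f ∘ T^k)‖_∞ = ∑_{k ∈ I_n} |c_k|` for all real coefficients. -/
theorem cantor_pos_entropy_iff_ell1 {X : Type*} [MetricSpace X] [CompactSpace X]
    [Nonempty X] [TotallyDisconnectedSpace X] [PerfectSpace X] (T : X ≃ₜ X) :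
    0 < Dynamics.coverEntropy (⇑T) Set.univ ↔
      ∃ (f : C(X, ℝ)) (I : ℕ → Finset ℕ),
        (∀ n, I n ⊆ Finset.range n) ∧
        0 < Filter.atTop.limsup (fun n => ((I n).card : ℝ) / (n : ℝ)) ∧
        ∀ (n : ℕ) (c : ℕ → ℝ),
          ‖∑ k ∈ I n, c k • f.comp ⟨(⇑T)^[k], T.continuous.iterate k⟩‖
            = ∑ k ∈ I n, |c k| := by
  constructor
  · intro h
    obtain ⟨A, hA, β, hβ, hfreq⟩ := exists_isClopen_frequently_exp_le_card_hittingFamily h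
    have hshat : ∀ n, ∃ t, (hittingFamily T A n).Shatters t ∧
        (Real.exp (β * n) ≤ #(hittingFamily T A n) → β ^ 2 / 4 * n ≤ #t) := by
      intro n
      by_cases hn : Real.exp (β * n) ≤ #(hittingFamily T A n)
      · obtain ⟨t, ht, hle⟩ := exists_shatters_of_exp_le_card
          (𝒜 := hittingFamily T A n) (S := range n)
          (fun t ht ↦ by
            obtain ⟨x, rfl⟩ := mem_hittingFamily.1 ht
            exact hittingTimes_subset_range) hβ (by rwa [card_range])
        exact ⟨t, ht, fun _ ↦ by rwa [card_range] at hle⟩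
      · exact ⟨∅, shatters_empty.2 hittingFamily_nonempty, fun h' ↦ absurd h' hn⟩
    choose I hI hcard using hshat
    have hIn : ∀ n, I n ⊆ range n := fun n ↦ subset_range_of_shatters_hittingFamily (hI n)
    refine ⟨clopenSign hA, I, hIn, ?_, fun n c ↦
      norm_sum_clopenSign_comp_of_shatters T.continuous hA (hI n) c⟩
    refine (by positivity : (0 : ℝ) < β ^ 2 / 4).trans_le
      (le_limsup_of_frequently_le ?_ (isBoundedUnder_card_div hIn))
    refine (hfreq.and_eventually (eventually_gt_atTop 0)).mono fun n hn ↦ ?_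
    rw [le_div_iff₀ (by exact_mod_cast hn.2)]
    exact hcard n hn.1
  · rintro ⟨f, I, hI, hlim, h⟩
    exact coverEntropy_pos_of_norm_sum_eq T.continuous T.surjective hI hlim h
end

section
/- Let X be a compact metric space, T : X → X a homeomorphism, f : X → ℝ a continuous function with ‖f‖_∞ ≤ 1, and D ≥ 1. Suppose there exist, for each n ∈ ℕ, subsets I_n ⊆ {0, 1, …, n−1} with limsup_{n→∞} |I_n|/n > 0 such that for each n and all real coefficients (c_k)_{k ∈ I_n}, the supremum norm satisfies ‖Σ_{k ∈ I_n} c_k · (f ∘ T^k)‖_∞ ≥ D^{-1} · Σ_{k ∈ I_n} |c_k|. Then the topological entropy of T is strictly positive. -/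
open Finset

/-- **Moment generating function bound for Rademacher sums.** The sum ranges over the sign vectors
on `s`, encoded by the subset of `s` on which the sign is `+1`. -/
lemma sum_powerset_exp_signed_sum_le {ι : Type*} [DecidableEq ι] (s : Finset ι) (a : ι → ℝ)
    (ha : ∀ k ∈ s, |a k| ≤ 1) (t : ℝ) :
    ∑ A ∈ s.powerset, Real.exp (t * ∑ k ∈ s, (if k ∈ A then 1 else -1) * a k)
      ≤ 2 ^ #s * Real.exp (#s * (t ^ 2 / 2)) := by
  have key : ∏ k ∈ s, (Real.exp (t * a k) + Real.exp (-(t * a k)))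
      = ∑ A ∈ s.powerset, Real.exp (t * ∑ k ∈ s, (if k ∈ A then 1 else -1) * a k) := by
    rw [Finset.prod_add]
    refine Finset.sum_congr rfl fun A hA ↦ ?_
    rw [Finset.mem_powerset] at hA
    rw [← Real.exp_sum, ← Real.exp_sum, ← Real.exp_add, ← Finset.sum_sdiff hA, mul_add,
      Finset.mul_sum, Finset.mul_sum, add_comm]
    congr 2
    · refine Finset.sum_congr rfl fun k hk ↦ ?_
      rw [if_neg (Finset.mem_sdiff.1 hk).2]
      ring
    · refine Finset.sum_congr rfl fun k hk ↦ ?_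
      rw [if_pos hk, one_mul]
  rw [← key, Real.exp_nat_mul, ← mul_pow]
  rw [← Finset.prod_const]
  refine Finset.prod_le_prod (fun _ _ ↦ by positivity) fun k hk ↦ ?_
  have hcosh := Real.cosh_le_exp_half_sq (t * a k)
  rw [Real.cosh_eq] at hcosh
  have hsq : (t * a k) ^ 2 ≤ t ^ 2 := by
    rw [mul_pow]
    exact mul_le_of_le_one_right (sq_nonneg t) ((sq_le_one_iff_abs_le_one _).2 (ha k hk))
  have hexp : Real.exp ((t * a k) ^ 2 / 2) ≤ Real.exp (t ^ 2 / 2) := by gcongr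
  linarith

/-- If every sign vector on `s` has correlation at least `2 * t * #s` in absolute value with one of
finitely many vectors in the unit cube, then there are exponentially many such vectors. -/
lemma exp_le_two_mul_card_of_signed_sums {ι α : Type*} [DecidableEq ι] (s : Finset ι)
    (S : Finset α) (a : α → ι → ℝ) (ha : ∀ y ∈ S, ∀ k ∈ s, |a y k| ≤ 1) {t : ℝ} (ht : 0 ≤ t)
    (h : ∀ A ∈ s.powerset, ∃ y ∈ S,
      t * #s ≤ |∑ k ∈ s, (if k ∈ A then 1 else -1) * a y k|) :
    Real.exp (#s * (t ^ 2 / 2)) ≤ 2 * #S := by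
  set c : α → Finset ι → ℝ := fun y A ↦ ∑ k ∈ s, (if k ∈ A then 1 else -1) * a y k
  have hA : ∀ A ∈ s.powerset, Real.exp (t * (t * #s))
      ≤ ∑ y ∈ S, (Real.exp (t * c y A) + Real.exp (-t * c y A)) := by
    intro A hA
    obtain ⟨y, hy, hle⟩ := h A hA
    refine le_trans ?_ (Finset.single_le_sum
      (f := fun y ↦ Real.exp (t * c y A) + Real.exp (-t * c y A)) (fun _ _ ↦ by positivity) hy)
    rcases le_abs.1 hle with h1 | h1
    · have : Real.exp (t * (t * #s)) ≤ Real.exp (t * c y A) := by gcongr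
      linarith [Real.exp_pos (-t * c y A)]
    · have : Real.exp (t * (t * #s)) ≤ Real.exp (-t * c y A) := by
        rw [neg_mul, ← mul_neg]
        gcongr
      linarith [Real.exp_pos (t * c y A)]
  have hsum : 2 ^ #s * Real.exp (t * (t * #s))
      ≤ #S * (2 * (2 ^ #s * Real.exp (#s * (t ^ 2 / 2)))) := by
    calc 2 ^ #s * Real.exp (t * (t * #s))
        = ∑ A ∈ s.powerset, Real.exp (t * (t * #s)) := by simp
      _ ≤ ∑ A ∈ s.powerset, ∑ y ∈ S, (Real.exp (t * c y A) + Real.exp (-t * c y A)) :=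
          Finset.sum_le_sum hA
      _ = ∑ y ∈ S, ∑ A ∈ s.powerset, (Real.exp (t * c y A) + Real.exp (-t * c y A)) :=
          Finset.sum_comm
      _ ≤ ∑ y ∈ S, 2 * (2 ^ #s * Real.exp (#s * (t ^ 2 / 2))) := by
          refine Finset.sum_le_sum fun y hy ↦ ?_
          rw [Finset.sum_add_distrib, two_mul]
          have hneg := sum_powerset_exp_signed_sum_le s (a y) (ha y hy) (-t)
          rw [neg_sq] at hneg
          exact add_le_add (sum_powerset_exp_signed_sum_le s (a y) (ha y hy) t) hneg
      _ = _ := by rw [Finset.sum_const, nsmul_eq_mul]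
  have hsplit : Real.exp (t * (t * #s))
      = Real.exp (#s * (t ^ 2 / 2)) * Real.exp (#s * (t ^ 2 / 2)) := by
    rw [← Real.exp_add]
    ring_nf
  have hpos : 0 < 2 ^ #s * Real.exp (#s * (t ^ 2 / 2)) := by positivity
  refine le_of_mul_le_mul_left ?_ hpos
  rw [hsplit] at hsum
  linarith

/-- If `f, f ∘ T, …` restricted to times in `s ⊆ {0, …, n - 1}` is `D`-isomorphic to the standard
basis of `ℓ¹`, then dynamical covers at time `n` have cardinality exponential in `#s`. -/
lemma exp_le_two_mul_card_of_isDynCoverOf {X : Type*} [MetricSpace X] [CompactSpace X]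
    [Nonempty X] {T : X → X} (hT : Continuous T) {f : C(X, ℝ)} (hf : ‖f‖ ≤ 1) {D : ℝ}
    (hD : 0 < D) {n : ℕ} {s : Finset ℕ} (hs : s ⊆ Finset.range n)
    (h : ∀ c : ℕ → ℝ, D⁻¹ * ∑ k ∈ s, |c k| ≤ ‖∑ k ∈ s, c k • f.comp ⟨T^[k], hT.iterate k⟩‖)
    {S : Finset X}
    (hS : Dynamics.IsDynCoverOf T Set.univ {p | |f p.1 - f p.2| < D⁻¹ / 2} n S) :
    Real.exp (#s * ((D⁻¹ / 2) ^ 2 / 2)) ≤ 2 * #S := by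
  refine exp_le_two_mul_card_of_signed_sums s S (fun y k ↦ f (T^[k] y))
    (fun y _ k _ ↦ (f.norm_coe_le_norm _).trans hf) (by positivity) fun A _ ↦ ?_
  set c : ℕ → ℝ := fun k ↦ if k ∈ A then 1 else -1 with hc
  have habs : ∀ k, |c k| = 1 := fun k ↦ by
    simp only [hc]
    split_ifs <;> simp
  obtain ⟨x, hx⟩ : ∃ x, D⁻¹ * #s ≤ |∑ k ∈ s, c k * f (T^[k] x)| := by
    by_contra! hlt
    have hnorm : ‖∑ k ∈ s, c k • f.comp ⟨T^[k], hT.iterate k⟩‖ < D⁻¹ * #s := by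
      rw [ContinuousMap.norm_lt_iff_of_nonempty]
      intro x
      simpa [ContinuousMap.sum_apply] using hlt x
    have := h c
    simp only [habs, Finset.sum_const, nsmul_eq_mul, mul_one] at this
    linarith
  obtain ⟨y, hy, hxy⟩ := hS (Set.mem_univ x)
  rw [Dynamics.mem_dynEntourage] at hxy
  refine ⟨y, hy, ?_⟩
  have hdiff : |∑ k ∈ s, c k * f (T^[k] x) - ∑ k ∈ s, c k * f (T^[k] y)| ≤ #s * (D⁻¹ / 2) := by
    rw [← Finset.sum_sub_distrib, ← nsmul_eq_mul]
    refine (Finset.abs_sum_le_sum_abs _ _).trans (Finset.sum_le_card_nsmul _ _ _ fun k hk ↦ ?_)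
    rw [← mul_sub, abs_mul, habs, one_mul]
    exact (hxy k (Finset.mem_range.1 (hs hk))).le
  have := abs_sub_abs_le_abs_sub (∑ k ∈ s, c k * f (T^[k] x)) (∑ k ∈ s, c k * f (T^[k] y))
  linarith

/-- Let `X` be a compact metric space, `T : X → X` a homeomorphism, `f : X → ℝ`
continuous with `‖f‖_∞ ≤ 1`, and `D ≥ 1`. Suppose there are subsets
`I_n ⊆ {0, …, n-1}` with `limsup |I_n|/n > 0` such that for every `n` and all real
coefficients `(c_k)`, `‖∑_{k ∈ I_n} c_k · (f ∘ T^k)‖_∞ ≥ D⁻¹ · ∑_{k ∈ I_n} |c_k|`. Then the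
topological entropy of `T` (Bowen–Dinaburg entropy via dynamical covers, w.r.t. the uniform
structure of the metric, the unique one compatible with the topology) is strictly positive. -/
theorem pos_entropy_of_ell1_isomorphs {X : Type*} [MetricSpace X] [CompactSpace X]
    (T : X ≃ₜ X) (f : C(X, ℝ)) (hf : ‖f‖ ≤ 1) (D : ℝ) (hD : 1 ≤ D)
    (I : ℕ → Finset ℕ) (hIn : ∀ n, I n ⊆ Finset.range n)
    (hlim : 0 < Filter.atTop.limsup (fun n => ((I n).card : ℝ) / (n : ℝ)))
    (hbasis : ∀ (n : ℕ) (c : ℕ → ℝ),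
      D⁻¹ * ∑ k ∈ I n, |c k|
        ≤ ‖∑ k ∈ I n, c k • f.comp ⟨(⇑T)^[k], T.continuous.iterate k⟩‖) :
    0 < Dynamics.coverEntropy (⇑T) Set.univ := by
  have hD0 : 0 < D := one_pos.trans_le hD
  obtain ⟨δ, hδ, hδlim⟩ := exists_between hlim
  have hfreq : ∃ᶠ n in Filter.atTop, δ < ((I n).card : ℝ) / (n : ℝ) :=
    Filter.frequently_lt_of_lt_limsup (Filter.isCoboundedUnder_le_of_le _ (x := 0)
      fun n ↦ by positivity) hδlim
  have : Nonempty X := by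
    by_contra hX
    rw [not_nonempty_iff] at hX
    obtain ⟨n, hn⟩ := hfreq.exists
    have h0 := hbasis n 1
    rw [ContinuousMap.norm_eq_iSup_norm] at h0
    simp only [Pi.one_apply, abs_one, Finset.sum_const, nsmul_eq_mul, mul_one,
      Real.iSup_of_isEmpty] at h0
    have hcard : ((I n).card : ℝ) ≤ 0 := nonpos_of_mul_nonpos_right h0 (by positivity)
    have := div_nonpos_of_nonpos_of_nonneg hcard n.cast_nonneg
    linarith
  set U : SetRel X X := {p | |f p.1 - f p.2| < D⁻¹ / 2}
  have hUmem : U ∈ uniformity X :=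
    (CompactSpace.uniformContinuous_of_continuous f.continuous)
      (Metric.dist_mem_uniformity (by positivity : 0 < D⁻¹ / 2))
  set b : ℝ := (D⁻¹ / 2) ^ 2 / 2
  have hb0 : 0 < b := by positivity
  refine lt_of_lt_of_le ?_ (Dynamics.coverEntropyEntourage_le_coverEntropy (⇑T) Set.univ hUmem)
  have hpos : (0 : EReal) < ((δ * b / 2 : ℝ) : EReal) := by
    exact_mod_cast (by positivity : 0 < δ * b / 2)
  refine hpos.trans_le (Frequently.le_expGrowthSup ?_)
  have hlarge : ∀ᶠ n : ℕ in Filter.atTop, Real.log 2 ≤ (δ * b / 2) * n :=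
    (tendsto_natCast_atTop_atTop.const_mul_atTop (by positivity)).eventually_ge_atTop _
  refine (hfreq.and_eventually (hlarge.and (Filter.eventually_gt_atTop 0))).mono ?_
  rintro n ⟨hn, hlog, hn0⟩
  rcases eq_or_lt_of_le (le_top (a := Dynamics.coverMincard (⇑T) Set.univ U n)) with htop | hfin
  · simp [htop]
  obtain ⟨S, hS, hcard⟩ := (Dynamics.coverMincard_finite_iff (⇑T) Set.univ U n).1 hfin
  have hexp := exp_le_two_mul_card_of_isDynCoverOf T.continuous hf hD0 (hIn n) (hbasis n) hS
  have hn0' : (0 : ℝ) < n := by exact_mod_cast hn0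
  rw [lt_div_iff₀ hn0'] at hn
  have hle : Real.exp (δ * b / 2 * n) ≤ #S := by
    have h1 : Real.exp (Real.log 2 + δ * b / 2 * n) ≤ Real.exp (#(I n) * b) := by
      gcongr
      nlinarith
    rw [Real.exp_add, Real.exp_log two_pos] at h1
    linarith
  rw [← hcard, show ((δ * b / 2 : ℝ) : EReal) * (n : EReal) = ((δ * b / 2 * n : ℝ) : EReal) by
    push_cast; rfl, EReal.exp_coe]
  simpa using ENNReal.ofReal_le_ofReal hle
end

section
/- Let σ be the homeomorphism of the one-point compactification ℤ ∪ {∞} of the integers defined by σ(n) = n + 1 for n ∈ ℤ and σ(∞) = ∞. Let A be a closed unital star-subalgebra of the C*-algebra C(ℤ ∪ {∞}, ℂ) of continuous complex-valued functions which is globally invariant under the induced automorphism, i.e., f ∘ σ ∈ A and f ∘ σ⁻¹ ∈ A for every f ∈ A, and suppose A ≠ C(ℤ ∪ {∞}, ℂ). Then every f ∈ A is a constant function. Consequently, the only globally invariant closed unital star-subalgebras of C(ℤ ∪ {∞}, ℂ) are the scalar multiples of the unit and C(ℤ ∪ {∞}, ℂ) itself. -/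
open OnePoint

/-- A sequence of distinct integers converges to the point at infinity. -/
theorem OnePoint.tendsto_intCast_infty_of_injective {u : ℕ → ℤ} (hu : Function.Injective u) :
    Filter.Tendsto (fun i => (u i : OnePoint ℤ)) Filter.atTop (nhds ∞) := by
  have h : Filter.Tendsto ((↑) : ℤ → OnePoint ℤ) Filter.cofinite (nhds ∞) := by
    rw [← Filter.cocompact_eq_cofinite, ← Filter.coclosedCompact_eq_cocompact]
    exact OnePoint.tendsto_coe_infty
  exact h.comp (Nat.cofinite_eq_atTop ▸ hu.tendsto_cofinite)

/-- A continuous function on `ℤ ∪ {∞}` whose restriction to `ℤ` has a nonzero period takes the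
value at infinity everywhere. -/
theorem ContinuousMap.eq_infty_of_periodic {Y : Type*} [TopologicalSpace Y] [T2Space Y]
    (f : C(OnePoint ℤ, Y)) {d : ℤ} (hd : d ≠ 0)
    (hf : Function.Periodic (fun n : ℤ => f (n : OnePoint ℤ)) d) (x : OnePoint ℤ) :
    f x = f ∞ := by
  induction x using OnePoint.rec with
  | infty => rfl
  | coe k =>
    have hu : Function.Injective (fun i : ℕ => k + i * d) := fun i j hij => by
      simpa [hd] using hij
    have hlim := (f.continuous.tendsto ∞).comp (OnePoint.tendsto_intCast_infty_of_injective hu)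
    refine tendsto_nhds_unique (tendsto_const_nhds.congr fun i => ?_) hlim
    exact ((hf.nat_mul i) k).symm

/-- Let `σ` be the homeomorphism of the one-point compactification `ℤ ∪ {∞}`
of the integers with `σ(n) = n + 1` for `n ∈ ℤ` and `σ(∞) = ∞` (its inverse `τ` satisfies
`τ(n) = n - 1`, `τ(∞) = ∞`). Let `A` be a closed unital star-subalgebra of
`C(ℤ ∪ {∞}, ℂ)` which is globally invariant under the induced automorphism (`f ∘ σ ∈ A` and
`f ∘ σ⁻¹ ∈ A` for every `f ∈ A`) and with `A ≠ C(ℤ ∪ {∞}, ℂ)`. Then every `f ∈ A` is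
constant; consequently the only globally invariant closed unital star-subalgebras are the
scalars and the whole algebra. -/
theorem invariant_subalgebra_of_compactified_shift
    (σ τ : OnePoint ℤ → OnePoint ℤ)
    (hσ : ∀ n : ℤ, σ (n : OnePoint ℤ) = ((n + 1 : ℤ) : OnePoint ℤ))
    (hσ_infty : σ ∞ = ∞)
    (hτ : ∀ n : ℤ, τ (n : OnePoint ℤ) = ((n - 1 : ℤ) : OnePoint ℤ))
    (hτ_infty : τ ∞ = ∞)
    (A : StarSubalgebra ℂ C(OnePoint ℤ, ℂ))
    (hclosed : IsClosed (A : Set C(OnePoint ℤ, ℂ)))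
    (hinv : ∀ f ∈ A, (∃ g ∈ A, ⇑g = ⇑f ∘ σ) ∧ (∃ g ∈ A, ⇑g = ⇑f ∘ τ))
    (hproper : A ≠ ⊤) :
    ∀ f ∈ A, ∃ c : ℂ, ∀ x : OnePoint ℤ, f x = c := by
  have hshift : ∀ x y : ℤ → OnePoint ℤ, (∀ k, σ (x k) = x (k + 1)) → (∀ k, τ (x k) = x (k - 1)) →
      (∀ k, σ (y k) = y (k + 1)) → (∀ k, τ (y k) = y (k - 1)) →
      (∀ f ∈ A, f (x 0) = f (y 0)) → ∀ k, ∀ f ∈ A, f (x k) = f (y k) := by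
    intro x y hσx hτx hσy hτy h0 k
    induction k with
    | zero => exact h0
    | succ i ih =>
      intro f hf
      obtain ⟨g, hg, hgf⟩ := (hinv f hf).1
      simpa [hgf, hσx, hσy] using ih g hg
    | pred i ih =>
      intro f hf
      obtain ⟨g, hg, hgf⟩ := (hinv f hf).2
      simpa [hgf, hτx, hτy] using ih g hg
  have hσ_add (n k : ℤ) : σ ((n + k : ℤ) : OnePoint ℤ) = ((n + (k + 1) : ℤ) : OnePoint ℤ) := by
    rw [hσ, add_assoc]
  have hτ_add (n k : ℤ) : τ ((n + k : ℤ) : OnePoint ℤ) = ((n + (k - 1) : ℤ) : OnePoint ℤ) := by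
    rw [hτ, add_sub_assoc]
  have hcoe_infty (n : ℤ) (h : ∀ f ∈ A, f (n : OnePoint ℤ) = f ∞) :
      ∀ f ∈ A, ∀ x : OnePoint ℤ, f x = f ∞ := by
    intro f hf x
    induction x using OnePoint.rec with
    | infty => rfl
    | coe k =>
      have := hshift (fun k => ((n + k : ℤ) : OnePoint ℤ)) (fun _ => ∞) (hσ_add n) (hτ_add n)
        (fun _ => hσ_infty) (fun _ => hτ_infty) (by simpa using h) (k - n) f hf
      simpa using this
  have hcoe_coe (n m : ℤ) (hnm : n ≠ m)
      (h : ∀ f ∈ A, f (n : OnePoint ℤ) = f (m : OnePoint ℤ)) :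
      ∀ f ∈ A, ∀ x : OnePoint ℤ, f x = f ∞ := by
    intro f hf
    refine f.eq_infty_of_periodic (sub_ne_zero.mpr hnm.symm) fun k => ?_
    have := hshift (fun k => ((n + k : ℤ) : OnePoint ℤ)) (fun k => ((m + k : ℤ) : OnePoint ℤ))
      (hσ_add n) (hτ_add n) (hσ_add m) (hτ_add m) (by simpa using h) (k - n) f hf
    have hk : k + (m - n) = m + (k - n) := by ring
    simpa [hk] using this.symm
  have hnsep : ¬ A.SeparatesPoints := fun hsep => hproper <| by
    rw [← ContinuousMap.starSubalgebra_topologicalClosure_eq_top_of_separatesPoints A hsep]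
    exact SetLike.coe_injective hclosed.closure_eq.symm
  obtain ⟨x, y, hxy, h⟩ : ∃ x y, x ≠ y ∧ ∀ f ∈ A, f x = f y := by
    by_contra! hsep
    refine hnsep fun x y hxy => ?_
    obtain ⟨f, hf, hne⟩ := hsep x y hxy
    exact ⟨f, ⟨f, hf, rfl⟩, hne⟩
  intro f hf
  refine ⟨f ∞, ?_⟩
  induction x using OnePoint.rec with
  | infty =>
    induction y using OnePoint.rec with
    | infty => exact absurd rfl hxy
    | coe m => exact hcoe_infty m (fun f hf => (h f hf).symm) f hf
  | coe n =>
    induction y using OnePoint.rec with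
    | infty => exact hcoe_infty n h f hf
    | coe m => exact hcoe_coe n m (fun e => hxy (congrArg _ e)) h f hf
end

section
/- For every λ > 0 there exist c > 0 and n₀ ∈ ℕ such that for all n ≥ n₀ the following holds: if E is a subset of {−1, 1}^{\{0, …, n−1\}} with |E| ≥ e^{λ n}, then there exists a subset I ⊆ {0, …, n−1} with |I| ≥ c · n such that the set of restrictions {γ|_I : γ ∈ E} equals all of {−1, 1}^I (i.e., E shatters I). -/
open Finset

/-- Exponential-moment bound: a family of subsets of `α` all of size at most `r` has at most
`exp (r * t + exp (-t) * |α|)` members, for every `t ≥ 0`. -/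
theorem card_le_exp_of_forall_card_le {α : Type*} [Fintype α]
    (𝒜 : Finset (Finset α)) {r t : ℝ} (ht : 0 ≤ t) (h𝒜 : ∀ s ∈ 𝒜, (#s : ℝ) ≤ r) :
    (#𝒜 : ℝ) ≤ Real.exp (r * t + Real.exp (-t) * Fintype.card α) := by
  have moment : (#𝒜 : ℝ) * Real.exp (-(r * t)) ≤ Real.exp (Real.exp (-t) * Fintype.card α) :=
    calc (#𝒜 : ℝ) * Real.exp (-(r * t)) = ∑ s ∈ 𝒜, Real.exp (-(r * t)) := by simp
      _ ≤ ∑ s ∈ 𝒜, Real.exp (-t) ^ #s := by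
        refine sum_le_sum fun s hs => ?_
        rw [← Real.exp_nat_mul, Real.exp_le_exp]
        nlinarith [mul_le_mul_of_nonneg_right (h𝒜 s hs) ht]
      _ ≤ ∑ s : Finset α, Real.exp (-t) ^ #s :=
        sum_le_sum_of_subset_of_nonneg (subset_univ _) fun _ _ _ => by positivity
      _ = (Real.exp (-t) + 1) ^ Fintype.card α := by
        simpa using Fintype.sum_pow_mul_eq_add_pow α (Real.exp (-t)) 1
      _ ≤ Real.exp (Real.exp (-t)) ^ Fintype.card α := by
        gcongr
        exact Real.add_one_le_exp _
      _ = Real.exp (Real.exp (-t) * Fintype.card α) := by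
        rw [← Real.exp_nat_mul, mul_comm]
  rwa [Real.exp_neg, ← div_eq_mul_inv, div_le_iff₀ (Real.exp_pos _), ← Real.exp_add,
    add_comm] at moment

/-- **Pajor's inequality** for sign vectors: there are at least `|E|` sets shattered by the
family of positive supports of the elements of `E`. -/
theorem card_le_card_shatterer_posSupport {α : Type*} [Fintype α] [DecidableEq α]
    (E : Finset (α → ℤ)) (hE : ∀ γ ∈ E, ∀ i, γ i = -1 ∨ γ i = 1) :
    #E ≤ #(E.image fun γ => ({i | γ i = 1} : Finset α)).shatterer := by
  refine le_trans (card_image_of_injOn fun γ hγ δ hδ h => ?_).ge (card_le_card_shatterer _)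
  funext i
  have hi : γ i = 1 ↔ δ i = 1 := by simpa using Finset.ext_iff.1 h i
  have := hE γ hγ i
  have := hE δ hδ i
  lia

/-- If the positive supports of sign vectors in `E` shatter `I`, then `E` realizes every sign
pattern on `I`. -/
theorem exists_eq_on_of_shatters_posSupport {α : Type*} [Fintype α] [DecidableEq α]
    {E : Finset (α → ℤ)} (hE : ∀ γ ∈ E, ∀ i, γ i = -1 ∨ γ i = 1) {I : Finset α}
    (hI : (E.image fun γ => ({i | γ i = 1} : Finset α)).Shatters I)
    (s : α → ℤ) (hs : ∀ i, s i = -1 ∨ s i = 1) : ∃ γ ∈ E, ∀ i ∈ I, γ i = s i := by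
  obtain ⟨u, hu, hIu⟩ := hI (filter_subset (fun i => s i = 1) I)
  obtain ⟨γ, hγ, rfl⟩ := mem_image.1 hu
  refine ⟨γ, hγ, fun i hi => ?_⟩
  have hiff : γ i = 1 ↔ s i = 1 := by simpa [hi] using Finset.ext_iff.1 hIu i
  have := hE γ hγ i
  have := hs i
  lia

/-- quantitative Sauer–Perles–Shelah lemma, Lemma 2.2 of Glasner–Weiss:
For every `λ > 0` there exist `c > 0` and `n₀ ∈ ℕ` such that for all `n ≥ n₀`, if
`E ⊆ {-1, 1}^{0, …, n-1}` has `|E| ≥ e^{λ n}`, then there is `I ⊆ {0, …, n-1}` with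
`|I| ≥ c · n` such that the restrictions of elements of `E` to `I` realize every sign
pattern in `{-1, 1}^I` (i.e. `E` shatters `I`). -/
theorem sauer_shelah_exponential (lam : ℝ) (hlam : 0 < lam) :
    ∃ (c : ℝ) (n₀ : ℕ), 0 < c ∧ ∀ n ≥ n₀, ∀ E : Finset (Fin n → ℤ),
      (∀ γ ∈ E, ∀ i, γ i = -1 ∨ γ i = 1) →
      Real.exp (lam * n) ≤ (E.card : ℝ) →
      ∃ I : Finset (Fin n), c * n ≤ (I.card : ℝ) ∧
        ∀ s : Fin n → ℤ, (∀ i, s i = -1 ∨ s i = 1) →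
          ∃ γ ∈ E, ∀ i ∈ I, γ i = s i := by
  refine ⟨lam ^ 2 / 16, 1, by positivity, fun n hn E hE hcard => ?_⟩
  by_contra! hsmall
  have hbound := card_le_exp_of_forall_card_le
    (E.image fun γ => ({i | γ i = 1} : Finset (Fin n))).shatterer
    (r := lam ^ 2 / 16 * n) (t := 4 / lam) (by positivity) fun I hI => by
      by_contra! hlarge
      obtain ⟨s, hs, hne⟩ := hsmall I hlarge.le
      obtain ⟨γ, hγ, heq⟩ := exists_eq_on_of_shatters_posSupport hE (mem_shatterer.1 hI) s hs
      obtain ⟨i, hi, hi'⟩ := hne γ hγ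
      exact hi' (heq i hi)
  have hpajor : (#E : ℝ) ≤ _ := Nat.cast_le.2 (card_le_card_shatterer_posSupport E hE)
  have hexp := Real.exp_le_exp.1 ((hcard.trans hpajor).trans hbound)
  have hx : Real.exp (-(4 / lam)) ≤ lam / 4 := by
    rw [Real.exp_neg, inv_le_comm₀ (Real.exp_pos _) (by positivity), inv_div]
    linarith [Real.add_one_le_exp (4 / lam)]
  have hn' : (0 : ℝ) < n := by exact_mod_cast hn
  have hct : lam ^ 2 / 16 * n * (4 / lam) = lam / 4 * n := by
    field_simp
    norm_num
  rw [hct, Fintype.card_fin] at hexp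
  nlinarith [mul_le_mul_of_nonneg_right hx hn'.le, mul_pos hlam hn']
end

section
/- There exists a universal constant a > 0 with the following property. Let A be a C*-algebra, let x_1, …, x_n ∈ A be self-adjoint elements satisfying ‖Σ_{i=1}^n a_i x_i‖ = Σ_{i=1}^n |a_i| for all real coefficients a_1, …, a_n, let 0 ≤ δ < 1, let k ≥ 2, and let φ : A → M_k(ℂ) and ψ : M_k(ℂ) → A be continuous linear maps with ‖φ‖ ≤ 1 and ‖ψ‖ ≤ 1 such that ‖ψ(φ(x_i)) − x_i‖ ≤ δ for each i = 1, …, n. Then n · (1 − δ)² ≤ a · log k. -/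
set_option synthInstance.maxHeartbeats 400000
set_option maxHeartbeats 1000000

open Finset

/-- The Rademacher sum `∑ i, ε i • y i` associated with a choice of signs. -/
def signSum {n : ℕ} {B : Type*} [AddCommGroup B] [Module ℝ B] (y : Fin n → B)
    (ε : Fin n → ℤˣ) : B :=
  ∑ i, (((ε i : ℤˣ) : ℤ) : ℝ) • y i

/-- The monomial `∏ i, ε i ^ a i` in the signs. -/
def signMonomial {n : ℕ} (a : Fin n → ℕ) (ε : Fin n → ℤˣ) : ℝ :=
  ∏ i, (((ε i : ℤˣ) : ℤ) : ℝ) ^ a i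

lemma signMonomial_mul {n : ℕ} (a : Fin n → ℕ) (ε : Fin n → ℤˣ) (i : Fin n) :
    signMonomial a ε * (((ε i : ℤˣ) : ℤ) : ℝ) = signMonomial (a + Pi.single i 1) ε := by
  unfold signMonomial
  simp only [Pi.add_apply, pow_add, prod_mul_distrib]
  congr 1
  rw [Finset.prod_eq_single i] <;> simp +contextual

lemma sum_signs_prod {n : ℕ} (f : Fin n → ℝ → ℝ) :
    ∑ ε : Fin n → ℤˣ, ∏ i, f i (((ε i : ℤˣ) : ℤ) : ℝ) = ∏ i, (f i 1 + f i (-1)) := by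
  rw [← Fintype.prod_sum fun (i : Fin n) (s : ℤˣ) => f i ((s : ℤ) : ℝ)]
  refine prod_congr rfl fun i _ => ?_
  rw [UnitsInt.univ, sum_pair (by decide)]
  simp

lemma sum_signMonomial_nonneg {n : ℕ} (a : Fin n → ℕ) :
    0 ≤ ∑ ε : Fin n → ℤˣ, signMonomial a ε := by
  unfold signMonomial
  rw [sum_signs_prod fun i s => s ^ a i]
  refine prod_nonneg fun i _ => ?_
  rcases neg_one_pow_eq_or ℝ (a i) with h | h <;> simp [h]

/-- `F` is dominated by `g` when each correlation of `F` with a sign monomial is bounded in norm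
by the corresponding correlation of `g`. -/
def SignDominated {n : ℕ} {B : Type*} [NormedRing B] [NormedAlgebra ℝ B]
    (F : (Fin n → ℤˣ) → B) (g : (Fin n → ℤˣ) → ℝ) : Prop :=
  ∀ a : Fin n → ℕ, ‖∑ ε, signMonomial a ε • F ε‖ ≤ ∑ ε, signMonomial a ε * g ε

lemma SignDominated.one {n : ℕ} {B : Type*} [NormedRing B] [NormedAlgebra ℝ B]
    (h1 : ‖(1 : B)‖ ≤ 1) :
    SignDominated (fun _ : Fin n → ℤˣ => (1 : B)) fun _ => 1 := by
  intro a
  rw [← sum_smul, norm_smul, Real.norm_of_nonneg (sum_signMonomial_nonneg a)]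
  simpa using mul_le_mul_of_nonneg_left h1 (sum_signMonomial_nonneg a)

lemma SignDominated.mul_signSum {n : ℕ} {B : Type*} [NormedRing B] [NormedAlgebra ℝ B]
    {F : (Fin n → ℤˣ) → B} {g : (Fin n → ℤˣ) → ℝ} (h : SignDominated F g)
    {y : Fin n → B} (hy : ∀ i, ‖y i‖ ≤ 1) :
    SignDominated (fun ε => F ε * signSum y ε)
      fun ε => g ε * signSum (fun _ => (1 : ℝ)) ε := by
  intro a
  have h1 : ∑ ε, signMonomial a ε • (F ε * signSum y ε)
      = ∑ i, (∑ ε, signMonomial (a + Pi.single i 1) ε • F ε) * y i := by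
    simp only [signSum, mul_sum, smul_sum, sum_mul]
    rw [sum_comm]
    refine sum_congr rfl fun i _ => sum_congr rfl fun ε _ => ?_
    rw [← signMonomial_mul, mul_smul_comm, smul_smul, smul_mul_assoc]
  have h2 : ∑ ε, signMonomial a ε * (g ε * signSum (fun _ => (1 : ℝ)) ε)
      = ∑ i, ∑ ε, signMonomial (a + Pi.single i 1) ε * g ε := by
    simp only [signSum, mul_sum]
    rw [sum_comm]
    refine sum_congr rfl fun i _ => sum_congr rfl fun ε _ => ?_
    rw [← signMonomial_mul, smul_eq_mul]
    ring
  rw [h1, h2]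
  refine (norm_sum_le _ _).trans (sum_le_sum fun i _ => ?_)
  refine (norm_mul_le _ _).trans ((mul_le_of_le_one_right (norm_nonneg _) (hy i)).trans (h _))

lemma norm_sum_signSum_pow_le {n : ℕ} {B : Type*} [NormedRing B] [NormedAlgebra ℝ B]
    (h1 : ‖(1 : B)‖ ≤ 1) {y z : Fin n → B} (hy : ∀ i, ‖y i‖ ≤ 1) (hz : ∀ i, ‖z i‖ ≤ 1) (m : ℕ) :
    ‖∑ ε, (signSum z ε * signSum y ε) ^ m‖
      ≤ ∑ ε : Fin n → ℤˣ, signSum (fun _ => (1 : ℝ)) ε ^ (2 * m) := by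
  have key : SignDominated (fun ε => (signSum z ε * signSum y ε) ^ m)
      fun ε : Fin n → ℤˣ => signSum (fun _ => (1 : ℝ)) ε ^ (2 * m) := by
    induction m with
    | zero => simpa using SignDominated.one h1
    | succ m ih =>
      convert (ih.mul_signSum hz).mul_signSum hy using 2 with ε ε
      · rw [pow_succ, mul_assoc]
      · ring
  simpa [signMonomial] using key 0

lemma sum_exp_signSum_le (n : ℕ) (t : ℝ) :
    ∑ ε : Fin n → ℤˣ, Real.exp (t * signSum (fun _ => (1 : ℝ)) ε)
      ≤ 2 ^ n * Real.exp (n * (t ^ 2 / 2)) := by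
  have h : ∀ ε : Fin n → ℤˣ, Real.exp (t * signSum (fun _ => (1 : ℝ)) ε)
      = ∏ i, Real.exp (t * (((ε i : ℤˣ) : ℤ) : ℝ)) := fun ε => by
    rw [← Real.exp_sum, signSum, mul_sum]
    simp
  simp only [h]
  rw [sum_signs_prod fun _ s => Real.exp (t * s)]
  have h2 : Real.exp (t * 1) + Real.exp (t * (-1)) = 2 * Real.cosh t := by
    rw [Real.cosh_eq]
    simp
    ring
  rw [prod_const, h2, card_univ, Fintype.card_fin, mul_pow, Real.exp_nat_mul]
  gcongr
  exact Real.cosh_le_exp_half_sq t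

lemma sum_signSum_pow_le {n m : ℕ} (hn : 0 < n) (hm : 0 < m) :
    ∑ ε : Fin n → ℤˣ, signSum (fun _ => (1 : ℝ)) ε ^ (2 * m)
      ≤ 2 ^ n * (2 * (2 * m * n * Real.exp 1) ^ m) := by
  have hn' : (0 : ℝ) < n := by exact_mod_cast hn
  have hm' : (0 : ℝ) < m := by exact_mod_cast hm
  set t : ℝ := √(2 * m / n) with ht
  have ht2 : t ^ 2 = 2 * m / n := Real.sq_sqrt (by positivity)
  have htp : t ^ (2 * m) = (2 * m / n) ^ m := by rw [pow_mul, ht2]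
  have pt : ∀ s : ℝ, t ^ (2 * m) * s ^ (2 * m)
      ≤ (2 * m) ^ (2 * m) * (Real.exp (t * s) + Real.exp (-t * s)) := by
    intro s
    have h1 := Real.pow_div_factorial_le_exp |t * s| (abs_nonneg _) (2 * m)
    rw [div_le_iff₀ (by positivity), Even.pow_abs (even_two_mul m), mul_pow] at h1
    have h2 : Real.exp |t * s| ≤ Real.exp (t * s) + Real.exp (-t * s) := by
      rw [neg_mul]
      rcases abs_cases (t * s) with h | h <;> rw [h.1] <;>
        linarith [Real.exp_pos (t * s), Real.exp_pos (-(t * s))]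
    have h3 : ((2 * m).factorial : ℝ) ≤ (2 * m) ^ (2 * m) := by
      exact_mod_cast Nat.factorial_le_pow (2 * m)
    rw [mul_comm] at h1
    rw [mul_comm (Real.exp _)] at h1
    rw [mul_comm]
    exact h1.trans (by gcongr)
  have hsum : t ^ (2 * m) * ∑ ε : Fin n → ℤˣ, signSum (fun _ => (1 : ℝ)) ε ^ (2 * m)
      ≤ (2 * m) ^ (2 * m) * (2 * (2 ^ n * Real.exp 1 ^ m)) := by
    have he : ∀ u : ℝ, u ^ 2 = t ^ 2 → (n : ℝ) * (u ^ 2 / 2) = m := fun u hu => by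
      rw [hu, ht2]
      field_simp
    have e1 := sum_exp_signSum_le n t
    have e2 := sum_exp_signSum_le n (-t)
    rw [he _ rfl, ← Real.exp_one_pow] at e1
    rw [he _ (neg_sq t), ← Real.exp_one_pow] at e2
    rw [mul_sum]
    refine (sum_le_sum fun ε _ => pt _).trans ?_
    rw [← mul_sum, sum_add_distrib]
    gcongr
    linarith
  rw [htp] at hsum
  refine le_of_mul_le_mul_left (hsum.trans_eq ?_) (by positivity : (0 : ℝ) < (2 * m / n) ^ m)
  simp only [mul_pow, div_pow, pow_mul']
  field_simp

/-- The operator norm is dominated by the Hilbert–Schmidt norm. -/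
lemma sq_opNorm_le_sum {k : ℕ} (R : EuclideanSpace ℂ (Fin k) →L[ℂ] EuclideanSpace ℂ (Fin k)) :
    ‖R‖ ^ 2 ≤ ∑ j, ‖R (EuclideanSpace.single j 1)‖ ^ 2 := by
  have h0 : (0 : ℝ) ≤ ∑ j, ‖R (EuclideanSpace.single j 1)‖ ^ 2 := by positivity
  rw [← Real.sqrt_le_sqrt_iff h0, Real.sqrt_sq (norm_nonneg _)]
  refine R.opNorm_le_bound (Real.sqrt_nonneg _) fun v => ?_
  have hv : R v = ∑ j, v j • R (EuclideanSpace.single j 1) := by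
    conv_lhs => rw [← (EuclideanSpace.basisFun (Fin k) ℂ).sum_repr v]
    simp [map_sum]
  rw [hv, EuclideanSpace.norm_eq v, ← Real.sqrt_mul h0]
  refine Real.le_sqrt_of_sq_le ?_
  calc ‖∑ j, v j • R (EuclideanSpace.single j 1)‖ ^ 2
      ≤ (∑ j, ‖R (EuclideanSpace.single j 1)‖ * ‖v j‖) ^ 2 := by
        gcongr
        refine norm_sum_le_of_le _ fun j _ => ?_
        rw [norm_smul, mul_comm]
    _ ≤ _ := sum_mul_sq_le_sq_mul_sq _ _ _

open scoped InnerProductSpace in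
lemma norm_pow_le_sum_inner {k : ℕ}
    (S : EuclideanSpace ℂ (Fin k) →L[ℂ] EuclideanSpace ℂ (Fin k)) (r : ℕ) :
    ‖S‖ ^ (2 * (2 * 2 ^ r)) ≤ ∑ j : Fin k, (⟪EuclideanSpace.single j (1 : ℂ),
      ((star S * S) ^ (2 * 2 ^ r)) (EuclideanSpace.single j 1)⟫_ℂ).re := by
  have hP : IsSelfAdjoint (star S * S) := .star_mul_self S
  have hn : ‖S‖ ^ (2 * (2 * 2 ^ r)) = ‖(star S * S) ^ 2 ^ r‖ ^ 2 := by
    have hSS : ‖star S * S‖ = ‖S‖ * ‖S‖ :=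
      ContinuousLinearMap.norm_adjoint_comp_self S
    rw [hP.norm_pow_two_pow, hSS]
    ring
  rw [hn]
  refine (sq_opNorm_le_sum _).trans (sum_le_sum fun j _ => le_of_eq ?_)
  have hs : (star S * S) ^ (2 * 2 ^ r) = star ((star S * S) ^ 2 ^ r) * (star S * S) ^ 2 ^ r := by
    rw [(hP.pow _).star_eq, two_mul, pow_add]
  rw [hs, mul_apply_eq_comp, ContinuousLinearMap.star_eq_adjoint (_ ^ _),
    ContinuousLinearMap.adjoint_inner_right, inner_self_eq_norm_sq_to_K]
  norm_cast

lemma star_signSum {n : ℕ} {B : Type*} [AddCommGroup B] [Module ℝ B] [StarAddMonoid B]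
    (y : Fin n → B) (ε : Fin n → ℤˣ) :
    star (signSum y ε) = signSum (fun i => star (y i)) ε := by
  unfold signSum
  rw [star_sum]
  refine sum_congr rfl fun i _ => ?_
  rw [Int.cast_smul_eq_zsmul, Int.cast_smul_eq_zsmul, star_zsmul]

open scoped InnerProductSpace in
/-- Moment form of the noncommutative Khintchine inequality. -/
lemma sum_norm_signSum_pow_le {n k : ℕ}
    {y : Fin n → (EuclideanSpace ℂ (Fin k) →L[ℂ] EuclideanSpace ℂ (Fin k))}
    (hy : ∀ i, ‖y i‖ ≤ 1) (r : ℕ) :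
    ∑ ε, ‖signSum y ε‖ ^ (2 * (2 * 2 ^ r))
      ≤ k * ∑ ε : Fin n → ℤˣ, signSum (fun _ => (1 : ℝ)) ε ^ (2 * (2 * 2 ^ r)) := by
  have h1 : ‖(1 : EuclideanSpace ℂ (Fin k) →L[ℂ] EuclideanSpace ℂ (Fin k))‖ ≤ 1 :=
    ContinuousLinearMap.norm_id_le
  have hz : ∀ i, ‖star (y i)‖ ≤ 1 := fun i => (norm_star (y i)).trans_le (hy i)
  have hst : ∀ ε : Fin n → ℤˣ, star (signSum y ε) = signSum (fun i => star (y i)) ε :=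
    fun ε => star_signSum y ε
  have hB := norm_sum_signSum_pow_le h1 hy hz (2 * 2 ^ r)
  refine (sum_le_sum fun ε _ => norm_pow_le_sum_inner (signSum y ε) r).trans ?_
  rw [sum_comm]
  have hj : ∀ j ∈ (univ : Finset (Fin k)), ∑ ε : Fin n → ℤˣ,
      (⟪EuclideanSpace.single j (1 : ℂ), ((star (signSum y ε) * signSum y ε) ^ (2 * 2 ^ r))
        (EuclideanSpace.single j 1)⟫_ℂ).re
      ≤ ∑ ε : Fin n → ℤˣ, signSum (fun _ => (1 : ℝ)) ε ^ (2 * (2 * 2 ^ r)) := by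
    intro j _
    rw [← Complex.re_sum, ← inner_sum, ← _root_.sum_apply]
    simp only [hst]
    refine (Complex.re_le_norm _).trans ((norm_inner_le_norm _ _).trans (le_trans ?_ hB))
    refine (mul_le_mul_of_nonneg_left (ContinuousLinearMap.le_opNorm _ _) (norm_nonneg _)).trans ?_
    simp
  simpa using sum_le_sum hj

/-- There is a universal constant `a > 0` such that: if `A` is a C*-algebra,
`x_1, …, x_n ∈ A` are self-adjoint and form a standard basis of an isometric copy of real
`ℓ¹_n` (`‖∑ a_i x_i‖ = ∑ |a_i|` for real coefficients), `0 ≤ δ < 1`, `k ≥ 2`, and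
`φ : A → M_k(ℂ)`, `ψ : M_k(ℂ) → A` are continuous linear maps of norm at most `1` (with
`M_k(ℂ)` the `k × k` matrices with the `ℓ² → ℓ²` operator norm, realized as the operators on
`ℓ²_k = ℂ^k`) such that `‖ψ(φ(x_i)) - x_i‖ ≤ δ` for each `i`, then
`n · (1 - δ)² ≤ a · log k`. -/
theorem entropy_key_estimate :
    ∃ a : ℝ, 0 < a ∧
      ∀ (A : Type) [NormedRing A] [StarRing A] [CStarRing A] [NormedAlgebra ℂ A]
        [StarModule ℂ A],
        ∀ (n k : ℕ), 2 ≤ k →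
          ∀ x : Fin n → A, (∀ i, IsSelfAdjoint (x i)) →
            (∀ c : Fin n → ℝ, ‖∑ i, (c i : ℂ) • x i‖ = ∑ i, |c i|) →
            ∀ δ : ℝ, 0 ≤ δ → δ < 1 →
              ∀ (φ : A →L[ℂ] (EuclideanSpace ℂ (Fin k) →L[ℂ] EuclideanSpace ℂ (Fin k)))
                (ψ : (EuclideanSpace ℂ (Fin k) →L[ℂ] EuclideanSpace ℂ (Fin k)) →L[ℂ] A),
                ‖φ‖ ≤ 1 → ‖ψ‖ ≤ 1 →
                (∀ i, ‖ψ (φ (x i)) - x i‖ ≤ δ) →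
                (n : ℝ) * (1 - δ) ^ 2 ≤ a * Real.log k := by
  refine ⟨16 * Real.exp 1 ^ 2, by positivity, ?_⟩
  intro A _ _ _ _ _ n k hk x _ hx δ hδ0 hδ1 φ ψ hφ hψ hψφ
  have hk' : (2 : ℝ) ≤ k := by exact_mod_cast hk
  have hlog : Real.log 2 ≤ Real.log k := Real.log_le_log (by norm_num) hk'
  have hlog2 := Real.log_two_gt_d9
  rcases Nat.eq_zero_or_pos n with rfl | hn
  · have : 0 ≤ Real.log k := by linarith
    simp only [Nat.cast_zero, zero_mul]
    positivity
  have hn' : (0 : ℝ) < n := by exact_mod_cast hn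
  have hx1 : ∀ i, ‖x i‖ ≤ 1 := fun i => by
    have h := hx (Pi.single i 1)
    rw [sum_eq_single i, sum_eq_single i] at h <;> simp_all [Pi.single_apply]
  have hy : ∀ i, ‖φ (x i)‖ ≤ 1 := fun i =>
    (φ.le_of_opNorm_le hφ _).trans (by simpa using hx1 i)
  have low : ∀ ε : Fin n → ℤˣ, n * (1 - δ) ≤ ‖signSum (fun i => φ (x i)) ε‖ := by
    intro ε
    have habs : ∀ i, |(((ε i : ℤˣ) : ℤ) : ℝ)| = 1 := fun i => by
      rcases Int.units_eq_one_or (ε i) with h | h <;> simp [h]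
    have hs := hx fun i => (((ε i : ℤˣ) : ℤ) : ℝ)
    simp only [habs, sum_const, card_univ, Fintype.card_fin, nsmul_eq_mul, mul_one] at hs
    set c : Fin n → ℂ := fun i => ((((ε i : ℤˣ) : ℤ) : ℝ) : ℂ) with hc
    have hcn : ∀ i, ‖c i‖ = 1 := fun i => by
      rw [hc, Complex.norm_real, Real.norm_eq_abs, habs]
    have hS : signSum (fun i => φ (x i)) ε = ∑ i, c i • φ (x i) :=
      sum_congr rfl fun i _ => (Complex.coe_smul _ _).symm
    have hdiff : ‖ψ (∑ i, c i • φ (x i)) - ∑ i, c i • x i‖ ≤ n * δ := by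
      simp only [map_sum, map_smul, ← sum_sub_distrib, ← smul_sub]
      refine (norm_sum_le_of_le (f := fun i => c i • (ψ (φ (x i)) - x i)) univ
        (n := fun _ => δ) fun i _ => ?_).trans (by simp)
      rw [norm_smul, hcn, one_mul]
      exact hψφ i
    have hψS : ‖ψ (∑ i, c i • φ (x i))‖ ≤ ‖∑ i, c i • φ (x i)‖ :=
      (ψ.le_of_opNorm_le hψ _).trans (by simp)
    have htri := norm_sub_norm_le (∑ i, c i • x i) (ψ (∑ i, c i • φ (x i)))
    rw [norm_sub_rev, hs] at htri
    rw [hS]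
    linarith
  obtain ⟨r, hr1, hr2⟩ := exists_nat_pow_near (x := 2 * Real.log k) (y := (2 : ℝ))
    (by linarith) one_lt_two
  set m : ℕ := 2 * 2 ^ r with hm
  have hm_pos : 0 < m := by positivity
  have hmr : (m : ℝ) = 2 * 2 ^ r := by simp [hm]
  have hm_le : (m : ℝ) ≤ 4 * Real.log k := by linarith
  have hm_ge : 2 * Real.log k ≤ m := by
    rw [pow_succ] at hr2
    linarith
  have hexp : 2 * (k : ℝ) ≤ Real.exp 1 ^ m := by
    have h : (k : ℝ) ^ 2 ≤ Real.exp 1 ^ m := by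
      rw [Real.exp_one_pow, ← Real.log_le_iff_le_exp (by positivity), Real.log_pow]
      exact_mod_cast hm_ge
    nlinarith
  have hbound : (n * (1 - δ)) ^ (2 * m) ≤ (2 * m * n * Real.exp 1 ^ 2) ^ m := by
    have h1 : (2 : ℝ) ^ n * (n * (1 - δ)) ^ (2 * m)
        ≤ ∑ ε, ‖signSum (fun i => φ (x i)) ε‖ ^ (2 * m) := by
      have h := sum_le_sum fun (ε : Fin n → ℤˣ) (_ : ε ∈ univ) =>
        pow_le_pow_left₀ (by nlinarith) (low ε) (2 * m)
      simpa using h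
    have h2 := h1.trans ((sum_norm_signSum_pow_le hy r).trans
      (mul_le_mul_of_nonneg_left (sum_signSum_pow_le hn hm_pos) (by positivity)))
    have h3 : (n * (1 - δ)) ^ (2 * m) ≤ 2 * k * (2 * m * n * Real.exp 1) ^ m := by
      refine le_of_mul_le_mul_left (h2.trans_eq ?_) (by positivity : (0 : ℝ) < 2 ^ n)
      ring
    refine h3.trans ((mul_le_mul_of_nonneg_right hexp (by positivity)).trans_eq ?_)
    rw [← mul_pow]
    ring
  rw [pow_mul] at hbound
  have hfin := le_of_pow_le_pow_left₀ hm_pos.ne' (by positivity) hbound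
  have hfin2 : n * (1 - δ) ^ 2 ≤ 2 * m * Real.exp 1 ^ 2 := by
    refine le_of_mul_le_mul_left ?_ hn'
    linarith
  have he : (m : ℝ) * Real.exp 1 ^ 2 ≤ 4 * Real.log k * Real.exp 1 ^ 2 := by gcongr
  have : 0 ≤ Real.log k * Real.exp 1 ^ 2 := mul_nonneg (by linarith) (by positivity)
  linarith
end
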